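/- arXiv:2409.03684 — 7 statements merged into one kernel-verified Lean document; each statement's English description precedes it below -/
import Mathlib

section
/- Let D be a probability distribution on ℝ with mean μ ∈ (-1,1) and variance σ² satisfying 0 < σ² < 1 − μ². Let f : ℝⁿ → ℝ be a multilinear function satisfying |f(x)| ≤ 1 for all x ∈ [−1,1]ⁿ. Then for every natural number d there exists a multilinear function f^{≤d} : ℝⁿ → ℝ of total degree at most d such that E_{x ∼ D^{⊗n}}[(f(x) − f^{≤d}(x))²] ≤ (σ²/(1−μ²))^d. -/
open MeasureTheory

lemma shift_basis {n : ℕ} (c : Finset (Fin n) → ℝ) (m : ℝ) :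
    ∃ a : Finset (Fin n) → ℝ,
      (∀ x : Fin n → ℝ, ∑ S : Finset (Fin n), c S * ∏ i ∈ S, (x i + m)
        = ∑ S : Finset (Fin n), a S * ∏ i ∈ S, x i) ∧
      ∀ d : ℕ, (∀ S : Finset (Fin n), d < S.card → c S = 0) →
        ∀ S : Finset (Fin n), d < S.card → a S = 0 := by
  refine ⟨fun S => ∑ T : Finset (Fin n), if S ⊆ T then c T * m ^ (T \ S).card else 0, ?_, ?_⟩
  · intro x
    simp_rw [Finset.sum_mul]
    rw [Finset.sum_comm]
    refine Finset.sum_congr rfl fun T _ => ?_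
    rw [Finset.prod_add, Finset.mul_sum]
    simp_rw [ite_mul, zero_mul]
    rw [← Finset.sum_filter]
    refine Finset.sum_congr ?_ ?_
    · ext S; simp
    · intro S _
      simp only [Finset.prod_const]
      ring
  · intro d hc S hS
    refine Finset.sum_eq_zero fun T _ => ?_
    split_ifs with h
    · rw [hc T (lt_of_lt_of_le hS (Finset.card_le_card h)), zero_mul]
    · rfl

lemma l2_expand {n : ℕ} (D : Measure ℝ) [IsProbabilityMeasure D] (m v : ℝ)
    (h1 : Integrable (fun x : ℝ => x - m) D) (h2 : Integrable (fun x : ℝ => (x - m) ^ 2) D)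
    (hm : ∫ x, (x - m) ∂D = 0) (hv : ∫ x, (x - m) ^ 2 ∂D = v) (a : Finset (Fin n) → ℝ) :
    ∫ x, (∑ S : Finset (Fin n), a S * ∏ i ∈ S, (x i - m)) ^ 2
        ∂(Measure.pi fun _ : Fin n => D) = ∑ S : Finset (Fin n), a S ^ 2 * v ^ S.card := by
  let g : Finset (Fin n) → Finset (Fin n) → Fin n → ℝ → ℝ := fun S T i y =>
    (if i ∈ S then y - m else 1) * (if i ∈ T then y - m else 1)
  have hg : ∀ S T i, Integrable (g S T i) D := by
    intro S T i
    by_cases hS : i ∈ S <;> by_cases hT : i ∈ T <;> simp only [g, hS, hT, if_true, if_false]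
    · simpa [sq] using h2
    · simpa using h1
    · simpa using h1
    · simp
  have hgi : ∀ S T i, ∫ y, g S T i y ∂D =
      if i ∈ S then (if i ∈ T then v else 0) else (if i ∈ T then 0 else 1) := by
    intro S T i
    by_cases hS : i ∈ S <;> by_cases hT : i ∈ T <;> simp only [g, hS, hT, if_true, if_false]
    · simpa [sq] using hv
    · simpa using hm
    · simpa using hm
    · simp
  have hexp : ∀ x : Fin n → ℝ, (∑ S : Finset (Fin n), a S * ∏ i ∈ S, (x i - m)) ^ 2
      = ∑ S : Finset (Fin n), ∑ T : Finset (Fin n), (a S * a T) * ∏ i, g S T i (x i) := by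
    intro x
    rw [sq, Finset.sum_mul_sum]
    refine Finset.sum_congr rfl fun S _ => Finset.sum_congr rfl fun T _ => ?_
    simp only [g, Finset.prod_mul_distrib, Finset.prod_ite_mem, Finset.univ_inter]
    ring
  have hint : ∀ S T, Integrable (fun x : Fin n → ℝ => (a S * a T) * ∏ i, g S T i (x i))
      (Measure.pi fun _ : Fin n => D) := fun S T =>
    (Integrable.fintype_prod (fun i => hg S T i)).const_mul _
  simp_rw [hexp]
  rw [integral_finsetSum _ fun S _ => integrable_finsetSum _ fun T _ => hint S T]
  refine Finset.sum_congr rfl fun S _ => ?_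
  rw [integral_finsetSum _ fun T _ => hint S T]
  simp_rw [integral_const_mul, integral_fintype_prod_eq_prod, hgi]
  rw [Finset.sum_eq_single S]
  · have : ∀ i, (if i ∈ S then (if i ∈ S then v else 0) else (if i ∈ S then 0 else 1))
        = if i ∈ S then v else 1 := by intro i; by_cases h : i ∈ S <;> simp [h]
    simp_rw [this, Finset.prod_ite_mem, Finset.univ_inter, Finset.prod_const]
    ring
  · intro T _ hTS
    have : ∃ i, ¬ (i ∈ S ↔ i ∈ T) := by
      by_contra! h
      exact hTS (Finset.ext fun i => (h i).symm)
    obtain ⟨i, hi⟩ := this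
    rw [Finset.prod_eq_zero (Finset.mem_univ i), mul_zero]
    by_cases hS : i ∈ S <;> by_cases hT : i ∈ T <;> simp_all
  · simp

lemma coeff_bound {n : ℕ} (m : ℝ) (hm : m ∈ Set.Ioo (-1 : ℝ) 1) (a : Finset (Fin n) → ℝ)
    (hb : ∀ x : Fin n → ℝ, (∀ i, x i ∈ Set.Icc (-1 : ℝ) 1) →
      |∑ S : Finset (Fin n), a S * ∏ i ∈ S, (x i - m)| ≤ 1) :
    ∑ S : Finset (Fin n), a S ^ 2 * (1 - m ^ 2) ^ S.card ≤ 1 := by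
  obtain ⟨hl, hr⟩ := hm
  have hp : 0 ≤ (1 + m) / 2 := by linarith
  have hq : 0 ≤ (1 - m) / 2 := by linarith
  let D : Measure ℝ := ENNReal.ofReal ((1 + m) / 2) • Measure.dirac 1
    + ENNReal.ofReal ((1 - m) / 2) • Measure.dirac (-1)
  have hD : IsProbabilityMeasure D := by
    constructor
    simp only [D, Measure.add_apply, Measure.smul_apply, measure_univ, smul_eq_mul, mul_one]
    rw [← ENNReal.ofReal_add hp hq]
    rw [show (1 + m) / 2 + (1 - m) / 2 = 1 by ring, ENNReal.ofReal_one]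
  have hI : ∀ g : ℝ → ℝ, Integrable g D := fun g =>
    ((integrable_dirac (by simp)).smul_measure ENNReal.ofReal_ne_top).add_measure
      ((integrable_dirac (by simp)).smul_measure ENNReal.ofReal_ne_top)
  have hInt : ∀ g : ℝ → ℝ, ∫ x, g x ∂D = (1 + m) / 2 * g 1 + (1 - m) / 2 * g (-1) := by
    intro g
    simp only [D]
    rw [integral_add_measure
      ((integrable_dirac (by simp)).smul_measure ENNReal.ofReal_ne_top)
      ((integrable_dirac (by simp)).smul_measure ENNReal.ofReal_ne_top)]
    simp [integral_smul_measure, ENNReal.toReal_ofReal hp, ENNReal.toReal_ofReal hq]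
  rw [← l2_expand D m (1 - m ^ 2) (hI _) (hI _) (by rw [hInt]; ring) (by rw [hInt]; ring) a]
  have hae : ∀ᵐ y ∂D, y ∈ Set.Icc (-1 : ℝ) 1 := by
    simp only [D]
    rw [ae_add_measure_iff]
    constructor
    · refine Measure.ae_smul_measure ?_ _
      rw [ae_dirac_eq]; simp
    · refine Measure.ae_smul_measure ?_ _
      rw [ae_dirac_eq]; simp
  have hpi : ∀ᵐ x ∂(Measure.pi fun _ : Fin n => D), ∀ i, x i ∈ Set.Icc (-1 : ℝ) 1 := by
    rw [ae_all_iff]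
    intro i
    exact (Measure.tendsto_eval_ae_ae (μ := fun _ : Fin n => D) (i := i)).eventually hae
  calc _ ≤ ∫ x, (1 : ℝ) ∂(Measure.pi fun _ : Fin n => D) := by
        refine integral_mono_of_nonneg (Filter.Eventually.of_forall fun x => sq_nonneg _)
          (integrable_const _) ?_
        filter_upwards [hpi] with x hx
        exact (sq_le_one_iff_abs_le_one _).2 (hb x hx)
    _ = 1 := by simp

/-- Let `D` be a probability distribution on `ℝ` with mean `μ ∈ (-1,1)` and variance
`σ² ∈ (0, 1 - μ²)`.  Let `f : ℝⁿ → ℝ` be multilinear (given by coefficients `c` over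
subsets of coordinates) with `|f x| ≤ 1` on `[-1,1]ⁿ`.  Then for every `d` there is a
multilinear `f^{≤d}` of total degree at most `d` with
`E_{x ∼ D^{⊗n}}[(f x - f^{≤d} x)²] ≤ (σ²/(1-μ²))^d`. -/
theorem low_degree_approximation_classical
    (n : ℕ) (D : Measure ℝ) [IsProbabilityMeasure D]
    (μ σ2 : ℝ) (hμ : μ ∈ Set.Ioo (-1 : ℝ) 1)
    (hmean : ∫ x, x ∂D = μ)
    (hvar : ∫ x, (x - μ) ^ 2 ∂D = σ2)
    (hσpos : 0 < σ2) (hσlt : σ2 < 1 - μ ^ 2)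
    (f : (Fin n → ℝ) → ℝ) (c : Finset (Fin n) → ℝ)
    (hf : ∀ x, f x = ∑ S : Finset (Fin n), c S * ∏ i ∈ S, x i)
    (hbound : ∀ x : Fin n → ℝ, (∀ i, x i ∈ Set.Icc (-1 : ℝ) 1) → |f x| ≤ 1)
    (d : ℕ) :
    ∃ c' : Finset (Fin n) → ℝ,
      (∀ S : Finset (Fin n), d < S.card → c' S = 0) ∧
      ∫ x, (f x - ∑ S : Finset (Fin n), c' S * ∏ i ∈ S, x i) ^ 2
          ∂(Measure.pi fun _ : Fin n => D) ≤ (σ2 / (1 - μ ^ 2)) ^ d := by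
  have h2 : Integrable (fun x : ℝ => (x - μ) ^ 2) D := by
    by_contra h
    rw [integral_undef h] at hvar
    linarith
  have h1 : Integrable (fun x : ℝ => x - μ) D :=
    ((memLp_two_iff_integrable_sq (by fun_prop)).2 h2).integrable (by norm_num)
  have h0 : Integrable (fun x : ℝ => x) D := by
    refine (h1.add (integrable_const μ)).congr (Filter.Eventually.of_forall fun x => ?_)
    simp
  have hm0 : ∫ x, (x - μ) ∂D = 0 := by
    rw [integral_sub h0 (integrable_const μ), hmean]; simp
  obtain ⟨a, ha, -⟩ := shift_basis c μ
  have hfa : ∀ x, f x = ∑ S : Finset (Fin n), a S * ∏ i ∈ S, (x i - μ) := by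
    intro x
    rw [hf, ← ha (fun i => x i - μ)]
    simp
  have hco := coeff_bound μ hμ a (fun x hx => by rw [← hfa]; exact hbound x hx)
  obtain ⟨c', hc', hdeg⟩ := shift_basis (fun S => if S.card ≤ d then a S else 0) (-μ)
  refine ⟨c', hdeg d fun S hS => by simp [hS], ?_⟩
  have hdiff : ∀ x : Fin n → ℝ, f x - ∑ S : Finset (Fin n), c' S * ∏ i ∈ S, x i
      = ∑ S : Finset (Fin n), (if S.card ≤ d then 0 else a S) * ∏ i ∈ S, (x i - μ) := by
    intro x
    rw [hfa, ← hc', ← Finset.sum_sub_distrib]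
    refine Finset.sum_congr rfl fun S _ => ?_
    split_ifs <;> simp [sub_eq_add_neg]
  simp_rw [hdiff]
  rw [l2_expand D μ σ2 h1 h2 hm0 hvar]
  have hpos : 0 < 1 - μ ^ 2 := by linarith
  have hr0 : 0 ≤ σ2 / (1 - μ ^ 2) := by positivity
  have hr1 : σ2 / (1 - μ ^ 2) ≤ 1 := (div_le_one hpos).2 hσlt.le
  calc _ ≤ ∑ S : Finset (Fin n), (σ2 / (1 - μ ^ 2)) ^ d * (a S ^ 2 * (1 - μ ^ 2) ^ S.card) := by
        refine Finset.sum_le_sum fun S _ => ?_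
        split_ifs with h
        · have : 0 ≤ (σ2 / (1 - μ ^ 2)) ^ d * (a S ^ 2 * (1 - μ ^ 2) ^ S.card) := by positivity
          simpa using this
        · have e : σ2 ^ S.card = (σ2 / (1 - μ ^ 2)) ^ S.card * (1 - μ ^ 2) ^ S.card := by
            rw [← mul_pow, div_mul_cancel₀ _ hpos.ne']
          have hle : (σ2 / (1 - μ ^ 2)) ^ S.card ≤ (σ2 / (1 - μ ^ 2)) ^ d :=
            pow_le_pow_of_le_one hr0 hr1 (by omega)
          rw [e]
          calc _ = (σ2 / (1 - μ ^ 2)) ^ S.card * (a S ^ 2 * (1 - μ ^ 2) ^ S.card) := by ring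
            _ ≤ _ := mul_le_mul_of_nonneg_right hle (by positivity)
    _ = (σ2 / (1 - μ ^ 2)) ^ d * ∑ S : Finset (Fin n), a S ^ 2 * (1 - μ ^ 2) ^ S.card := by
        rw [Finset.mul_sum]
    _ ≤ _ := mul_le_of_le_one_right (by positivity) hco
end

section
/- Let μ ∈ (−1,1) and let M be the 2×2 complex matrix M = [[1, iμ],[−iμ, 1]]. For any k ≥ 1, let M^{⊗k} denote the k-fold Kronecker power of M, and let N be the 2^k × 2^k real matrix whose entries are the real parts of the corresponding entries of M^{⊗k}. Then N is symmetric and its smallest eigenvalue is at least (1−μ²)^{k/2}; equivalently, vᵀNv ≥ (1−μ²)^{k/2}·‖v‖² for every real vector v ∈ ℝ^{2^k}. -/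
open Matrix

lemma kron_mul_aux {k : ℕ} (A B C : Matrix (Fin 2) (Fin 2) ℂ) (h : A * B = C)
    (a b : Fin k → Fin 2) :
    ∏ i, C (a i) (b i) =
      ∑ d : Fin k → Fin 2, (∏ i, A (a i) (d i)) * (∏ i, B (d i) (b i)) := by
  subst h
  simp only [Matrix.mul_apply]
  rw [Finset.prod_univ_sum, Fintype.piFinset_univ]
  simp only [Finset.prod_mul_distrib]

lemma kron_one_aux {k : ℕ} (s : ℂ) (a b : Fin k → Fin 2) :
    ∏ i, (s • (1 : Matrix (Fin 2) (Fin 2) ℂ)) (a i) (b i) = if a = b then s ^ k else 0 := by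
  split_ifs with h
  · subst h
    simp
  · obtain ⟨i, hi⟩ := Function.ne_iff.mp h
    apply Finset.prod_eq_zero (Finset.mem_univ i)
    simp [hi]

lemma kron_exists_aux (μ : ℝ) (hμ : μ ∈ Set.Ioo (-1 : ℝ) 1) :
    ∃ p q : ℝ, p ^ 2 + q ^ 2 = 1 ∧ 2 * p * q = μ ∧ p ^ 2 - q ^ 2 = √(1 - μ ^ 2) := by
  obtain ⟨h1, h2⟩ := hμ
  have e1 := Real.sq_sqrt (show 0 ≤ 1 + μ by linarith)
  have e2 := Real.sq_sqrt (show 0 ≤ 1 - μ by linarith)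
  refine ⟨(√(1 + μ) + √(1 - μ)) / 2, (√(1 + μ) - √(1 - μ)) / 2, ?_, ?_, ?_⟩
  · linear_combination (e1 + e2) / 2
  · linear_combination (e1 - e2) / 2
  · rw [show 1 - μ ^ 2 = (1 + μ) * (1 - μ) by ring,
      Real.sqrt_mul (show 0 ≤ 1 + μ by linarith)]
    ring

/-- Let `μ ∈ (-1,1)` and `M = [[1, iμ],[−iμ, 1]]`.  For `k ≥ 1` let `N` be the real
`2^k × 2^k` matrix of real parts of the entries of the `k`-fold Kronecker power of `M`
(indexed by `Fin k → Fin 2`).  Then `N` is symmetric and its smallest eigenvalue is at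
least `(1-μ²)^{k/2}`, i.e. `vᵀ N v ≥ (1-μ²)^{k/2} ‖v‖²` for every real `v`. -/
theorem real_part_kronecker_power_eigenvalue_lower_bound
    (μ : ℝ) (hμ : μ ∈ Set.Ioo (-1 : ℝ) 1) (k : ℕ) (hk : 1 ≤ k) :
    letI M : Matrix (Fin 2) (Fin 2) ℂ := !![1, Complex.I * μ; -(Complex.I * μ), 1]
    letI N : Matrix (Fin k → Fin 2) (Fin k → Fin 2) ℝ :=
      Matrix.of fun a b => (∏ i, M (a i) (b i)).re
    Nᵀ = N ∧
      ∀ v : (Fin k → Fin 2) → ℝ,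
        (1 - μ ^ 2) ^ ((k : ℝ) / 2) * ∑ a, v a ^ 2 ≤ v ⬝ᵥ N.mulVec v := by
  set M : Matrix (Fin 2) (Fin 2) ℂ := !![1, Complex.I * μ; -(Complex.I * μ), 1] with hMdef
  set N : Matrix (Fin k → Fin 2) (Fin k → Fin 2) ℝ :=
    Matrix.of fun a b => (∏ i, M (a i) (b i)).re with hNdef
  have hM : ∀ x y, M y x = star (M x y) := by
    intro x y
    fin_cases x <;> fin_cases y <;> simp [M]
  refine ⟨?_, ?_⟩
  · ext a b
    simp only [N, Matrix.transpose_apply, Matrix.of_apply]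
    have : ∏ i, M (b i) (a i) = star (∏ i, M (a i) (b i)) := by
      rw [star_prod]
      exact Finset.prod_congr rfl fun i _ => hM _ _
    rw [this]
    exact Complex.conj_re _
  · intro v
    obtain ⟨p, q, h1, h2, h3⟩ := kron_exists_aux μ hμ
    have hc : (1 - μ ^ 2) ^ ((k : ℝ) / 2) = (√(1 - μ ^ 2)) ^ k := by
      have h0 : 0 ≤ 1 - μ ^ 2 := by nlinarith [hμ.1, hμ.2]
      rw [Real.sqrt_eq_rpow, ← Real.rpow_natCast _ k, ← Real.rpow_mul h0]
      congr 1
      ring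
    rw [hc, ← h3]
    have h1' : (p : ℂ) ^ 2 + (q : ℂ) ^ 2 = 1 := by exact_mod_cast h1
    have h2' : 2 * (p : ℂ) * (q : ℂ) = μ := by exact_mod_cast h2
    set S : Matrix (Fin 2) (Fin 2) ℂ :=
      !![(p : ℂ), Complex.I * q; -(Complex.I * q), (p : ℂ)] with hS
    have hSS : S * S = M := by
      ext x y
      fin_cases x <;> fin_cases y <;> simp [S, M, Matrix.mul_apply] <;>
        first
        | linear_combination h1' - (q : ℂ) ^ 2 * Complex.I_sq
        | linear_combination Complex.I * h2'
        | linear_combination -Complex.I * h2'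
    have hSC : S * S.map star = ((p ^ 2 - q ^ 2 : ℝ) : ℂ) • (1 : Matrix (Fin 2) (Fin 2) ℂ) := by
      ext x y
      fin_cases x <;> fin_cases y <;> simp [S, Matrix.mul_apply] <;>
        first
        | ring1
        | linear_combination (q : ℂ) ^ 2 * Complex.I_sq
    have hSh : ∀ x y, S y x = star (S x y) := by
      intro x y
      fin_cases x <;> fin_cases y <;> simp [S]
    set T : (Fin k → Fin 2) → (Fin k → Fin 2) → ℂ := fun a b => ∏ i, S (a i) (b i) with hT
    have hTh : ∀ a b, T b a = star (T a b) := by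
      intro a b
      simp only [hT, star_prod]
      exact Finset.prod_congr rfl fun i _ => hSh _ _
    have hN : ∀ a b, N a b = (if a = b then (p ^ 2 - q ^ 2) ^ k else 0)
        + 2 * ∑ d, (T d a).im * (T d b).im := by
      intro a b
      have e1 := kron_mul_aux S S M hSS a b
      have e2 := kron_mul_aux S (S.map star) _ hSC a b
      rw [kron_one_aux] at e2
      have e3 : ∀ d : Fin k → Fin 2,
          ∏ i, (S.map star) (d i) (b i) = star (T d b) := by
        intro d
        simp [hT, Matrix.map_apply]
      simp only [e3] at e2
      have e1' := congrArg Complex.re e1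
      have e2' := congrArg Complex.re e2
      have e4 : (if a = b then (((p ^ 2 - q ^ 2 : ℝ) : ℂ)) ^ k else 0).re
          = if a = b then (p ^ 2 - q ^ 2) ^ k else 0 := by
        split_ifs
        · rw [← Complex.ofReal_pow, Complex.ofReal_re]
        · simp
      rw [e4] at e2'
      change (∏ i, M (a i) (b i)).re = _
      rw [e1', e2', Complex.re_sum, Complex.re_sum, Finset.mul_sum, ← Finset.sum_add_distrib]
      refine Finset.sum_congr rfl fun d _ => ?_
      change (T a d * T d b).re = (T a d * star (T d b)).re + _
      rw [hTh d a]
      simp [Complex.mul_re]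
      ring
    have key : v ⬝ᵥ N.mulVec v = (p ^ 2 - q ^ 2) ^ k * ∑ a, v a ^ 2
        + 2 * ∑ d, (∑ a, (T d a).im * v a) ^ 2 := by
      simp only [dotProduct, Matrix.mulVec, hN, add_mul, Finset.sum_add_distrib, mul_add,
        ite_mul, zero_mul, Finset.sum_ite_eq, Finset.mem_univ, if_true]
      congr 1
      · rw [Finset.mul_sum]
        exact Finset.sum_congr rfl fun a _ => by ring
      · simp only [sq, Finset.mul_sum, Finset.sum_mul]
        symm
        rw [Finset.sum_comm]
        refine Finset.sum_congr rfl fun a _ => ?_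
        rw [Finset.sum_comm]
        refine Finset.sum_congr rfl fun b _ => ?_
        exact Finset.sum_congr rfl fun d _ => by ring
    rw [key]
    have : 0 ≤ ∑ d, (∑ a, (T d a).im * v a) ^ 2 := Finset.sum_nonneg fun _ _ => sq_nonneg _
    linarith
end

section
/- Let μ ∈ [−1,1], let k ≥ 1, and let x ∈ {−1,1}^k. Then Σ_{S ⊆ [k], |S| even} μ^{|S|} ∏_{i∈S} x_i = ½(∏_{i=1}^k (1 + μx_i) + ∏_{i=1}^k (1 − μx_i)) ≥ (1−μ²)^{k/2}. -/
/-- For `μ ∈ [-1,1]`, `k ≥ 1` and `x ∈ {-1,1}^k`,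
`∑_{S ⊆ [k], |S| even} μ^{|S|} ∏_{i∈S} x i = ½(∏ (1 + μ x i) + ∏ (1 - μ x i))`, and this
quantity is at least `(1-μ²)^{k/2}`. -/
theorem even_subset_sum_identity_and_lower_bound
    (μ : ℝ) (hμ : μ ∈ Set.Icc (-1 : ℝ) 1) (k : ℕ) (hk : 1 ≤ k)
    (x : Fin k → ℝ) (hx : ∀ i, x i = 1 ∨ x i = -1) :
    (∑ S ∈ Finset.univ.filter (fun S : Finset (Fin k) => Even S.card),
        μ ^ S.card * ∏ i ∈ S, x i)
      = (1 / 2) * ((∏ i, (1 + μ * x i)) + ∏ i, (1 - μ * x i)) ∧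
    (1 - μ ^ 2) ^ ((k : ℝ) / 2)
      ≤ (1 / 2) * ((∏ i, (1 + μ * x i)) + ∏ i, (1 - μ * x i)) := by
  constructor
  · have h1 : ∏ i, (1 + μ * x i) = ∑ S : Finset (Fin k), μ ^ S.card * ∏ i ∈ S, x i := by
      rw [Finset.prod_one_add, Finset.powerset_univ]
      refine Finset.sum_congr rfl fun S _ => ?_
      rw [Finset.prod_mul_distrib, Finset.prod_const]
    have h2 : ∏ i, (1 - μ * x i)
        = ∑ S : Finset (Fin k), (-1) ^ S.card * (μ ^ S.card * ∏ i ∈ S, x i) := by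
      have h3 : ∀ i, 1 - μ * x i = 1 + (-1) * (μ * x i) := fun i => by ring
      simp only [h3]
      rw [Finset.prod_one_add, Finset.powerset_univ]
      refine Finset.sum_congr rfl fun S _ => ?_
      rw [Finset.prod_mul_distrib, Finset.prod_mul_distrib, Finset.prod_const, Finset.prod_const]
    rw [h1, h2, ← Finset.sum_add_distrib, Finset.mul_sum, Finset.sum_filter]
    refine Finset.sum_congr rfl fun S _ => ?_
    split_ifs with h
    · rw [h.neg_one_pow]; ring
    · rw [(Nat.not_even_iff_odd.mp h).neg_one_pow]; ring
  · obtain ⟨hl, hu⟩ := hμ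
    have hA : 0 ≤ ∏ i, (1 + μ * x i) := Finset.prod_nonneg fun i _ => by
      rcases hx i with h | h <;> rw [h] <;> linarith
    have hB : 0 ≤ ∏ i, (1 - μ * x i) := Finset.prod_nonneg fun i _ => by
      rcases hx i with h | h <;> rw [h] <;> linarith
    have hAB : (∏ i, (1 + μ * x i)) * ∏ i, (1 - μ * x i) = (1 - μ ^ 2) ^ k := by
      rw [← Finset.prod_mul_distrib]
      have h : ∀ i, (1 + μ * x i) * (1 - μ * x i) = 1 - μ ^ 2 := fun i => by
        rcases hx i with h | h <;> rw [h] <;> ring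
      simp [h]
    have h0 : 0 ≤ 1 - μ ^ 2 := by nlinarith
    have hr : ((1 - μ ^ 2) ^ ((k : ℝ) / 2)) ^ 2 = (1 - μ ^ 2) ^ k := by
      rw [← Real.rpow_mul_natCast h0, ← Real.rpow_natCast (1 - μ ^ 2) k]
      congr 1
      push_cast
      ring
    refine (abs_le_of_sq_le_sq' ?_ (by positivity)).2
    rw [hr, ← hAB]
    nlinarith [sq_nonneg ((∏ i, (1 + μ * x i)) - ∏ i, (1 - μ * x i))]
end

section
/- Let η ∈ (0,1) and μ ∈ ℝ, and let S be a 3×3 real symmetric positive semidefinite matrix with tr(S) = 1 and operator norm ‖S‖_op ≤ 1−η. Let v = (0,0,μ)ᵀ and suppose Σ := S − vvᵀ is positive semidefinite (so in particular μ² ≤ 1−η). Let Δ = diag((1−μ²)^{−1/4}, (1−μ²)^{−1/4}, (1−μ²)^{−1/2}). Then ‖ΔΣΔ‖_op ≤ 1 − η′, where η′ = min{ η·(1 − √(1−η/2))/(1−η/2), η/2 }. -/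
noncomputable section

/-- The `ℓ₂ → ℓ₂` operator (spectral) norm of a square matrix. -/
def opNorm {𝕜 : Type*} [RCLike 𝕜] {m : Type*} [Fintype m] [DecidableEq m]
    (M : Matrix m m 𝕜) : ℝ :=
  ‖LinearMap.toContinuousLinearMap (Matrix.toEuclideanLin M)‖

open Matrix MatrixOrder in
theorem aux_factor (M : Matrix (Fin 3) (Fin 3) ℝ) (hM : M.PosSemidef) :
    ∃ B : Matrix (Fin 3) (Fin 3) ℝ, M = Bᴴ * B := by
  obtain ⟨B, hB⟩ := CStarAlgebra.nonneg_iff_eq_star_mul_self.mp hM.nonneg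
  exact ⟨B, hB⟩

open Matrix in
theorem aux_sq_le (M : Matrix (Fin 3) (Fin 3) ℝ) (hM : M.PosSemidef) (x y : Fin 3 → ℝ) :
    (y ⬝ᵥ (M *ᵥ x)) ^ 2 ≤ (y ⬝ᵥ (M *ᵥ y)) * (x ⬝ᵥ (M *ᵥ x)) := by
  obtain ⟨B, rfl⟩ := aux_factor M hM
  have key : ∀ u w : Fin 3 → ℝ, u ⬝ᵥ ((Bᴴ * B) *ᵥ w) = (B *ᵥ u) ⬝ᵥ (B *ᵥ w) := by
    intro u w
    rw [← Matrix.mulVec_mulVec, Matrix.dotProduct_mulVec, Matrix.conjTranspose_eq_transpose_of_trivial,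
      Matrix.vecMul_transpose]
  rw [key, key, key]
  have := Finset.sum_mul_sq_le_sq_mul_sq Finset.univ (B *ᵥ y) (B *ᵥ x)
  simpa [dotProduct, sq] using this

open Matrix in
theorem aux_le_trace (M : Matrix (Fin 3) (Fin 3) ℝ) (hM : M.PosSemidef) (x : Fin 3 → ℝ) :
    x ⬝ᵥ (M *ᵥ x) ≤ M.trace * (x ⬝ᵥ x) := by
  obtain ⟨B, rfl⟩ := aux_factor M hM
  rw [← Matrix.mulVec_mulVec, Matrix.dotProduct_mulVec, Matrix.conjTranspose_eq_transpose_of_trivial,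
      Matrix.vecMul_transpose]
  have h : ∀ i, (B *ᵥ x) i * (B *ᵥ x) i ≤ (∑ j, B i j ^ 2) * (x ⬝ᵥ x) := by
    intro i
    have := Finset.sum_mul_sq_le_sq_mul_sq Finset.univ (B i) x
    simpa [mulVec, dotProduct, sq] using this
  have h2 := Finset.sum_le_sum (fun i (_ : i ∈ Finset.univ) => h i)
  have h3 : (Bᵀ * B).trace = ∑ i, ∑ j, B i j ^ 2 := by
    simp only [Matrix.trace, Matrix.diag, Matrix.mul_apply, Matrix.transpose_apply]
    rw [Finset.sum_comm]
    simp [sq]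
  rw [h3, Finset.sum_mul]
  exact h2

open Matrix in
theorem aux_opNorm_le (M : Matrix (Fin 3) (Fin 3) ℝ) (hM : M.PosSemidef) (c : ℝ) (hc : 0 ≤ c)
    (h : ∀ x : Fin 3 → ℝ, x ⬝ᵥ (M *ᵥ x) ≤ c * (x ⬝ᵥ x)) : opNorm M ≤ c := by
  unfold opNorm
  refine ContinuousLinearMap.opNorm_le_bound _ hc fun v => ?_
  have hn : ∀ w : EuclideanSpace ℝ (Fin 3), ‖w‖ ^ 2 = w.ofLp ⬝ᵥ w.ofLp := by
    intro w
    rw [EuclideanSpace.real_norm_sq_eq]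
    simp [dotProduct, sq]
  have hv := hn v
  have hw := hn (LinearMap.toContinuousLinearMap (Matrix.toEuclideanLin M) v)
  set x := v.ofLp with hx
  have hMx : (LinearMap.toContinuousLinearMap (Matrix.toEuclideanLin M) v).ofLp = M *ᵥ x := by
    simp [hx, Matrix.toLpLin_apply]
  rw [hMx] at hw
  set y := M *ᵥ x with hy
  refine abs_le_of_sq_le_sq' ?_ (by positivity) |>.2
  rw [mul_pow, hw, hv]
  have h1 := aux_sq_le M hM x y
  rw [← hy] at h1
  have h2 := h y
  have h3 := h x
  rw [← hy] at h3
  have hyy : 0 ≤ y ⬝ᵥ y := by rw [← hw]; positivity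
  have hxx : 0 ≤ x ⬝ᵥ x := by rw [← hv]; positivity
  have h0 : 0 ≤ x ⬝ᵥ y := by
    have := hM.dotProduct_mulVec_nonneg x
    simpa using this
  have h4 : (y ⬝ᵥ y) ^ 2 ≤ (c * (y ⬝ᵥ y)) * (c * (x ⬝ᵥ x)) :=
    h1.trans (mul_le_mul h2 h3 h0 (by positivity))
  rcases hyy.eq_or_lt with h5 | h5
  · rw [← h5]; positivity
  · nlinarith

open Matrix in
theorem aux_le_opNorm (M : Matrix (Fin 3) (Fin 3) ℝ) (x : Fin 3 → ℝ) :
    x ⬝ᵥ (M *ᵥ x) ≤ opNorm M * (x ⬝ᵥ x) := by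
  have hn : ‖WithLp.toLp 2 x‖ ^ 2 = x ⬝ᵥ x := by
    rw [EuclideanSpace.real_norm_sq_eq]
    simp [dotProduct, sq]
  have h1 := real_inner_le_norm (WithLp.toLp 2 x)
    (LinearMap.toContinuousLinearMap (Matrix.toEuclideanLin M) (WithLp.toLp 2 x))
  have h2 := (LinearMap.toContinuousLinearMap (Matrix.toEuclideanLin M)).le_opNorm (WithLp.toLp 2 x)
  have h3 : inner ℝ (WithLp.toLp 2 x)
    (LinearMap.toContinuousLinearMap (Matrix.toEuclideanLin M) (WithLp.toLp 2 x)) = x ⬝ᵥ (M *ᵥ x) := by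
    simp [EuclideanSpace.inner_eq_star_dotProduct, Matrix.toLpLin_apply, dotProduct_comm]
  rw [h3] at h1
  rw [← hn]
  have h4 := mul_le_mul_of_nonneg_left h2 (norm_nonneg (WithLp.toLp 2 x))
  unfold opNorm
  nlinarith

set_option maxHeartbeats 1000000 in
open Matrix in
/-- Let `η ∈ (0,1)`, `μ ∈ ℝ`, and `S` a `3×3` real symmetric PSD matrix with `tr S = 1` and
`‖S‖_op ≤ 1-η`.  Let `v = (0,0,μ)ᵀ` and suppose `Σ = S - vvᵀ` is PSD.  With
`Δ = diag((1-μ²)^{-1/4},(1-μ²)^{-1/4},(1-μ²)^{-1/2})` we have `‖ΔΣΔ‖_op ≤ 1-η'`,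
where `η' = min{η(1-√(1-η/2))/(1-η/2), η/2}`. -/
theorem scaled_covariance_operator_norm_bound
    (η : ℝ) (hη : η ∈ Set.Ioo (0 : ℝ) 1) (μ : ℝ)
    (S : Matrix (Fin 3) (Fin 3) ℝ) (hS : S.PosSemidef) (htr : S.trace = 1)
    (hSop : opNorm S ≤ 1 - η)
    (hSigma : (S - Matrix.vecMulVec ![0, 0, μ] ![0, 0, μ]).PosSemidef) :
    opNorm
        (Matrix.diagonal ![(1 - μ ^ 2) ^ (-(1 : ℝ) / 4), (1 - μ ^ 2) ^ (-(1 : ℝ) / 4),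
            (1 - μ ^ 2) ^ (-(1 : ℝ) / 2)] *
          (S - Matrix.vecMulVec ![0, 0, μ] ![0, 0, μ]) *
          Matrix.diagonal ![(1 - μ ^ 2) ^ (-(1 : ℝ) / 4), (1 - μ ^ 2) ^ (-(1 : ℝ) / 4),
            (1 - μ ^ 2) ^ (-(1 : ℝ) / 2)])
      ≤ 1 - min (η * (1 - Real.sqrt (1 - η / 2)) / (1 - η / 2)) (η / 2) := by
  obtain ⟨hη0, hη1⟩ := hη
  have hq : ∀ x : Fin 3 → ℝ, x ⬝ᵥ (S *ᵥ x) ≤ (1 - η) * (x ⬝ᵥ x) := fun x =>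
    (aux_le_opNorm S x).trans (mul_le_mul_of_nonneg_right hSop (by
      simp only [dotProduct]; exact Finset.sum_nonneg fun i _ => mul_self_nonneg _))
  have ht : S 2 2 ≤ 1 - η := by
    have := hq ![0, 0, 1]
    simpa [dotProduct, mulVec, Fin.sum_univ_three] using this
  have hμt : μ ^ 2 ≤ S 2 2 := by
    have := hSigma.diag_nonneg (i := 2)
    simp [Matrix.vecMulVec_apply] at this
    nlinarith
  have htr' : S 0 0 + S 1 1 + S 2 2 = 1 := by
    simpa [Matrix.trace, Fin.sum_univ_three] using htr
  have hm : 0 < 1 - μ ^ 2 := by linarith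
  have hm1 : 1 - μ ^ 2 ≤ 1 := by nlinarith
  have hμ2 : μ * μ = 1 - (1 - μ ^ 2) := by ring
  set m := 1 - μ ^ 2 with hmdef
  set s := Real.sqrt m with hs
  have hs0 : 0 < s := Real.sqrt_pos.mpr hm
  have hss : s * s = m := Real.mul_self_sqrt hm.le
  have hs1 : s ≤ 1 := by nlinarith
  set a := m ^ (-(1 : ℝ) / 4) with ha
  set b := m ^ (-(1 : ℝ) / 2) with hb
  have haa : a * a = s⁻¹ := by
    rw [ha, ← Real.rpow_add hm, hs, Real.sqrt_eq_rpow, ← Real.rpow_neg hm.le]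
    norm_num
  have hbb : b * b = m⁻¹ := by
    rw [hb, ← Real.rpow_add hm, ← Real.rpow_neg_one]
    norm_num
  set P := S - Matrix.vecMulVec ![0, 0, μ] ![0, 0, μ] with hP
  set D := Matrix.diagonal ![a, a, b] with hD
  have hM : (D * P * D).PosSemidef := by
    have h := hSigma.mul_mul_conjTranspose_same D
    have h2 : Dᴴ = D := by
      rw [hD, Matrix.conjTranspose_eq_transpose_of_trivial, Matrix.diagonal_transpose]
    rwa [h2] at h
  have hr : 0 < 1 - η / 2 := by linarith
  set r := Real.sqrt (1 - η / 2) with hrdef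
  have hr0 : 0 < r := Real.sqrt_pos.mpr hr
  have hrr : r * r = 1 - η / 2 := Real.mul_self_sqrt hr.le
  have hc : 0 ≤ 1 - min (η * (1 - r) / (1 - η / 2)) (η / 2) := by
    have := min_le_right (η * (1 - r) / (1 - η / 2)) (η / 2)
    linarith
  have hxx : ∀ x : Fin 3 → ℝ, 0 ≤ x ⬝ᵥ x := fun x => by
    simp only [dotProduct]; exact Finset.sum_nonneg fun i _ => mul_self_nonneg _
  refine aux_opNorm_le _ hM _ hc fun x => ?_
  rcases le_total m (1 - η / 2) with hcase | hcase
  · refine (aux_le_trace _ hM x).trans (mul_le_mul_of_nonneg_right ?_ (hxx x))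
    have hT : (D * P * D).trace = 1 - (1 - S 2 2) * ((1 - s) / m) := by
      have e : (D * P * D).trace = (a * a) * (S 0 0 + S 1 1) + (b * b) * (S 2 2 - μ * μ) := by
        simp [Matrix.trace, Fin.sum_univ_three, hD, hP, Matrix.vecMulVec_apply]
        ring
      rw [e, haa, hbb, hμ2, ← hss, show S 0 0 + S 1 1 = 1 - S 2 2 by linarith]
      field_simp
      ring
    have hsr : s ≤ r := Real.sqrt_le_sqrt hcase
    have hr1 : r ≤ 1 := by nlinarith
    have h1 : (1 - r) / (1 - η / 2) ≤ (1 - s) / m :=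
      div_le_div₀ (by linarith) (by linarith) hm hcase
    have h0 : 0 ≤ (1 - s) / m := div_nonneg (by linarith) hm.le
    have h2 : η * (1 - r) / (1 - η / 2) ≤ (1 - S 2 2) * ((1 - s) / m) := by
      rw [mul_div_assoc]
      exact (mul_le_mul_of_nonneg_left h1 hη0.le).trans
        (mul_le_mul_of_nonneg_right (by linarith) h0)
    have := min_le_left (η * (1 - r) / (1 - η / 2)) (η / 2)
    rw [hT]
    linarith
  · have e1 : x ⬝ᵥ ((D * P * D) *ᵥ x) =
        (D *ᵥ x) ⬝ᵥ (S *ᵥ (D *ᵥ x)) - (μ * (b * x 2)) ^ 2 := by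
      simp [dotProduct, mulVec, Fin.sum_univ_three, hD, hP, Matrix.vecMulVec_apply]
      ring
    have e2 : (D *ᵥ x) ⬝ᵥ (D *ᵥ x) = (a * a) * (x 0 * x 0 + x 1 * x 1) + (b * b) * (x 2 * x 2) := by
      simp [dotProduct, mulVec, Fin.sum_univ_three, hD]
      ring
    have e3 : x ⬝ᵥ x = x 0 * x 0 + x 1 * x 1 + x 2 * x 2 := by
      simp [dotProduct, Fin.sum_univ_three]
    have hsm : s⁻¹ ≤ m⁻¹ := inv_anti₀ hm (by nlinarith)
    have h4 : (D *ᵥ x) ⬝ᵥ (D *ᵥ x) ≤ m⁻¹ * (x ⬝ᵥ x) := by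
      rw [e2, e3, haa, hbb]
      have h : 0 ≤ x 0 * x 0 + x 1 * x 1 := add_nonneg (mul_self_nonneg _) (mul_self_nonneg _)
      have h' := mul_le_mul_of_nonneg_right hsm h
      linarith
    have h5 : (1 - η) * m⁻¹ ≤ 1 - η / 2 := by
      rw [← div_eq_mul_inv, div_le_iff₀ hm]
      nlinarith
    have h6 := hq (D *ᵥ x)
    have h7 := mul_le_mul_of_nonneg_left h4 (show 0 ≤ 1 - η by linarith)
    have h8 := mul_le_mul_of_nonneg_right h5 (hxx x)
    have h9 : (1 - η / 2) * (x ⬝ᵥ x) ≤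
        (1 - min (η * (1 - r) / (1 - η / 2)) (η / 2)) * (x ⬝ᵥ x) := by
      refine mul_le_mul_of_nonneg_right ?_ (hxx x)
      have := min_le_right (η * (1 - r) / (1 - η / 2)) (η / 2)
      linarith
    rw [e1]
    have := sq_nonneg (μ * (b * x 2))
    linarith


end
end

section
/- Let η ∈ (0,1) and let D be a probability distribution over single-qubit pure states whose Pauli second moment matrix S satisfies ‖S‖_op ≤ 1−η, and whose mean state is E_{ρ∼D}[ρ] = ½(I + μZ) for some μ ∈ ℝ (necessarily μ² ≤ 1−η). Define Z̃ = (Z − μI)/√(1−μ²), and for d ≥ 0 let V_d be the real span of all n-fold Kronecker products P₁ ⊗ ⋯ ⊗ P_n with each P_i ∈ {I, X, Y, Z̃} and at most d of the P_i different from I. Then for every 2ⁿ×2ⁿ Hermitian matrix O with ‖O‖_op ≤ 1 and every d ≥ 0, there exists O^{≤d} ∈ V_d such that E_{(ρ₁,…,ρ_n) ∼ D^{⊗n}}[(tr(O·(ρ₁⊗⋯⊗ρ_n)) − tr(O^{≤d}·(ρ₁⊗⋯⊗ρ_n)))²] ≤ (1−η′)^d, where η′ = min{ η·(1 − √(1−η/2))/(1−η/2),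 η/2 }. -/
open MeasureTheory ComplexOrder

noncomputable section

instance : MeasurableSpace (Matrix (Fin 2) (Fin 2) ℂ) :=
  inferInstanceAs (MeasurableSpace (Fin 2 → Fin 2 → ℂ))

/-- The Pauli matrices `X`, `Y`, `Z`. -/
def pauli : Fin 3 → Matrix (Fin 2) (Fin 2) ℂ :=
  ![!![0, 1; 1, 0], !![0, -Complex.I; Complex.I, 0], !![1, 0; 0, -1]]

/-- The shifted and rescaled Pauli `Z̃ = (Z - μ I)/√(1-μ²)`. -/
def Ztilde (μ : ℝ) : Matrix (Fin 2) (Fin 2) ℂ :=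
  (Real.sqrt (1 - μ ^ 2))⁻¹ • ((!![1, 0; 0, -1] : Matrix (Fin 2) (Fin 2) ℂ) - (μ : ℂ) • 1)

/-- The biased single-qubit basis `{I, X, Y, Z̃}`. -/
def biasedBasis (μ : ℝ) : Fin 4 → Matrix (Fin 2) (Fin 2) ℂ :=
  ![1, pauli 0, pauli 1, Ztilde μ]

/-- The `n`-fold Kronecker product of single-qubit matrices, as a matrix indexed by
`Fin n → Fin 2`. -/
def tens {n : ℕ} (ρ : Fin n → Matrix (Fin 2) (Fin 2) ℂ) :
    Matrix (Fin n → Fin 2) (Fin n → Fin 2) ℂ :=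
  Matrix.of fun a b => ∏ i, ρ i (a i) (b i)

/-- The Pauli second moment matrix of a distribution over single-qubit states. -/
def pauliSecondMoment (D : Measure (Matrix (Fin 2) (Fin 2) ℂ)) :
    Matrix (Fin 3) (Fin 3) ℝ :=
  Matrix.of fun i j => ∫ ρ, ((pauli i * ρ).trace).re * ((pauli j * ρ).trace).re ∂D


theorem sq_integrable_aux {E : Type*} [MeasurableSpace E] (D : Measure E) [IsProbabilityMeasure D]
    (ph : Fin 4 → E → ℝ) (hphph : ∀ j k, Integrable (fun x => ph j x * ph k x) D)
    (n : ℕ) (c : (Fin n → Fin 4) → ℝ) :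
    Integrable (fun x : Fin n → E => (∑ P, c P * ∏ i, ph (P i) (x i)) ^ 2)
      (Measure.pi fun _ : Fin n => D) := by
  have : (fun x : Fin n → E => (∑ P, c P * ∏ i, ph (P i) (x i)) ^ 2)
      = fun x => ∑ P, ∑ Q, (c P * c Q) * ∏ i, (ph (P i) (x i) * ph (Q i) (x i)) := by
    funext x
    rw [sq, Finset.sum_mul_sum]
    refine Finset.sum_congr rfl fun P _ => Finset.sum_congr rfl fun Q _ => ?_
    rw [Finset.prod_mul_distrib]; ring
  rw [this]
  refine integrable_finsetSum _ fun P _ => integrable_finsetSum _ fun Q _ => ?_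
  refine Integrable.const_mul ?_ _
  exact Integrable.fintype_prod (f := fun i x => ph (P i) x * ph (Q i) x) (fun i => hphph _ _)

theorem tensor_bound {E : Type*} [MeasurableSpace E] (D : Measure E) [IsProbabilityMeasure D]
    (ph : Fin 4 → E → ℝ) (hphph : ∀ j k, Integrable (fun x => ph j x * ph k x) D)
    (L : Fin 4 → ℝ) (hL : ∀ j, 0 ≤ L j)
    (h1 : ∀ u : Fin 4 → ℝ, ∫ x, (∑ j, u j * ph j x) ^ 2 ∂D ≤ ∑ j, L j * u j ^ 2)
    (n : ℕ) (c : (Fin n → Fin 4) → ℝ) :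
    ∫ x : Fin n → E, (∑ P, c P * ∏ i, ph (P i) (x i)) ^ 2 ∂(Measure.pi fun _ : Fin n => D)
      ≤ ∑ P, c P ^ 2 * ∏ i, L (P i) := by
  induction n with
  | zero => simp [measureReal_def]
  | succ n ih =>
    have hsum : ∀ f : (Fin (n+1) → Fin 4) → ℝ,
        ∑ P, f P = ∑ j, ∑ P : Fin n → Fin 4, f (Fin.cons j P) := by
      intro f
      rw [← (Fin.consEquiv (fun _ : Fin (n+1) => Fin 4)).sum_comp, Fintype.sum_prod_type]
      rfl
    have hmp := (measurePreserving_piFinSuccAbove (fun _ : Fin (n+1) => D) 0).symm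
    have hI := sq_integrable_aux D ph hphph (n+1) c
    set F : Fin 4 → (Fin n → E) → ℝ := fun j x => ∑ P : Fin n → Fin 4,
      c (Fin.cons j P) * ∏ i, ph (P i) (x i) with hF
    have key : ∀ y : E × (Fin n → E),
        (∑ P, c P * ∏ i, ph (P i)
          (((MeasurableEquiv.piFinSuccAbove (fun _ : Fin (n+1) => E) 0).symm y) i)) ^ 2
        = (∑ j, F j y.2 * ph j y.1) ^ 2 := by
      intro y
      congr 1
      rw [hsum]
      refine Finset.sum_congr rfl fun j _ => ?_
      rw [hF]; simp only
      rw [Finset.sum_mul]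
      refine Finset.sum_congr rfl fun P _ => ?_
      simp [MeasurableEquiv.piFinSuccAbove_symm_apply, Fin.prod_univ_succ, Fin.insertNthEquiv]
      ring
    have hI2 : Integrable (fun y : E × (Fin n → E) => (∑ j, F j y.2 * ph j y.1) ^ 2)
        (D.prod (Measure.pi fun _ : Fin n => D)) := by
      have := (hmp.integrable_comp_emb (MeasurableEquiv.measurableEmbedding _)).2 hI
      simpa only [Function.comp_def, key] using this
    have e1 : ∫ x : Fin (n+1) → E, (∑ P, c P * ∏ i, ph (P i) (x i)) ^ 2
          ∂(Measure.pi fun _ : Fin (n+1) => D)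
        = ∫ y : E × (Fin n → E), (∑ j, F j y.2 * ph j y.1) ^ 2
          ∂(D.prod (Measure.pi fun _ : Fin n => D)) := by
      rw [← hmp.integral_comp']
      simp only [key]
    rw [e1, integral_prod_symm _ hI2]
    have hFi : ∀ j, Integrable (fun x => F j x ^ 2) (Measure.pi fun _ : Fin n => D) := fun j =>
      sq_integrable_aux D ph hphph n _
    calc _ ≤ ∫ x, ∑ j, L j * F j x ^ 2 ∂(Measure.pi fun _ : Fin n => D) := by
            refine integral_mono hI2.integral_prod_right ?_ fun x => h1 fun j => F j x
            exact integrable_finsetSum _ fun j _ => (hFi j).const_mul _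
      _ = ∑ j, L j * ∫ x, F j x ^ 2 ∂(Measure.pi fun _ : Fin n => D) := by
            rw [integral_finsetSum _ fun j _ => (hFi j).const_mul _]
            simp only [integral_const_mul]
      _ ≤ ∑ j, L j * ∑ P : Fin n → Fin 4, c (Fin.cons j P) ^ 2 * ∏ i, L (P i) :=
            Finset.sum_le_sum fun j _ => mul_le_mul_of_nonneg_left (ih _) (hL j)
      _ = _ := by
            rw [hsum]
            refine Finset.sum_congr rfl fun j _ => ?_
            rw [Finset.mul_sum]
            refine Finset.sum_congr rfl fun P _ => ?_
            simp [Fin.prod_univ_succ]; ring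

/-- scalar inequality -/
theorem scalar_aux (η μ s r e V a b : ℝ) (hη0 : 0 < η) (hη1 : η < 1)
    (hs0 : 0 < s) (hs : s ^ 2 = 1 - μ ^ 2) (hsη : η ≤ s ^ 2)
    (hr0 : 0 < r) (hr : r ^ 2 = 1 - η / 2)
    (he0 : 0 ≤ e) (he1 : e ≤ η * (1 - r) / (1 - η / 2)) (he2 : e ≤ η / 2)
    (ha : 0 ≤ a) (hb : 0 ≤ b)
    (hV1 : V ≤ (1 - η) * (a + b) - μ ^ 2 * b) (hV2 : V ≤ s ^ 2 * (a + b)) :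
    V ≤ (1 - e) * (s * a + s ^ 2 * b) := by
  have hs1 : s ≤ 1 := by nlinarith [sq_nonneg μ]
  have hr1 : r < 1 := by nlinarith
  by_cases hc : r ≤ s
  · have h2 : 1 - η / 2 ≤ s ^ 2 := by nlinarith
    have h3 : 1 - η ≤ (1 - e) * s ^ 2 := by
      have : (1 - η/2) * (1 - η/2) ≤ (1-e) * s^2 :=
        mul_le_mul (by linarith) h2 (by linarith) (by linarith)
      nlinarith [sq_nonneg η]
    have h4 : (1 - e) * s ^ 2 ≤ (1-e) * s := by
      apply mul_le_mul_of_nonneg_left _ (by linarith); nlinarith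
    have := mul_le_mul_of_nonneg_right h3 hb
    have := mul_le_mul_of_nonneg_right (h3.trans h4) ha
    nlinarith [mul_nonneg (sq_nonneg μ) hb]
  · push Not at hc
    -- t = e s² / η
    have hre : e * r ^ 2 ≤ η * (1 - r) := by
      rw [hr]; rwa [le_div_iff₀ (by linarith)] at he1
    have hsr : s ^ 2 ≤ r ^ 2 := by nlinarith
    obtain ⟨t, ht⟩ : ∃ t, t * η = e * s ^ 2 := ⟨e * s ^ 2 / η, by field_simp⟩
    have ht0 : 0 ≤ t := by
      by_contra h; push Not at h
      nlinarith [mul_nonneg he0 (sq_nonneg s)]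
    have ht1 : t ≤ 1 := by
      by_contra h; push Not at h
      nlinarith [mul_nonneg he0 (sq_nonneg s)]
    have hxy : t * (1 - η) + (1 - t) * s ^ 2 ≤ (1 - e) * s := by
      obtain ⟨k, hk⟩ : ∃ k, e = k * η := ⟨e / η, by field_simp⟩
      have hk0 : 0 ≤ k := by
        by_contra h; push Not at h
        nlinarith
      have htk : t = k * s ^ 2 := by
        have : (t - k * s ^ 2) * η = 0 := by rw [hk] at ht; linarith
        rcases mul_eq_zero.1 this with h | h <;> linarith
      have hkr : k * r ^ 2 ≤ 1 - r := by
        by_contra h; push Not at h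
        rw [hk] at hre
        nlinarith
      have hη' : η = 2 * (1 - r ^ 2) := by linarith
      have hQ : s * (1 - η - s ^ 2) + η ≤ r ^ 2 := by
        have h5 : s * (1 - η - s ^ 2) ≤ s * (1 - 2 * η) :=
          mul_le_mul_of_nonneg_left (by linarith) hs0.le
        rcases le_total (1 - 2 * η) 0 with h | h
        · nlinarith
        · nlinarith
      have h6 : k * (s * (1 - η - s ^ 2) + η) ≤ 1 - s := by
        have := mul_le_mul_of_nonneg_left hQ hk0
        linarith
      have := mul_le_mul_of_nonneg_left h6 hs0.le
      rw [htk, hk]; linarith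
    have hz : t * (s ^ 2 - η) + (1 - t) * s ^ 2 = (1 - e) * s ^ 2 := by linarith
    have hV : V ≤ t * ((1 - η) * (a + b) - μ ^ 2 * b) + (1 - t) * (s ^ 2 * (a + b)) := by
      nlinarith [mul_le_mul_of_nonneg_left hV1 ht0, mul_le_mul_of_nonneg_left hV2 (sub_nonneg.2 ht1)]
    have hm : μ ^ 2 = 1 - s ^ 2 := by linarith
    rw [hm] at hV
    calc V ≤ _ := hV
      _ = (t * (1 - η) + (1 - t) * s ^ 2) * a + (t * (s ^ 2 - η) + (1 - t) * s ^ 2) * b := by ring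
      _ ≤ (1 - e) * s * a + (1 - e) * s ^ 2 * b := by
        rw [hz]; gcongr
      _ = _ := by ring

theorem trace_tens {n : ℕ} (A B : Fin n → Matrix (Fin 2) (Fin 2) ℂ) :
    (tens A * tens B).trace = ∏ i, (A i * B i).trace := by
  simp only [Matrix.trace, Matrix.diag, Matrix.mul_apply, tens, Matrix.of_apply]
  simp only [← Finset.prod_mul_distrib]
  rw [Fintype.prod_sum]
  refine Finset.sum_congr rfl fun a _ => ?_
  rw [Fintype.prod_sum]

theorem opNorm_col {m : Type*} [Fintype m] [DecidableEq m] (O : Matrix m m ℂ)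
    (h : opNorm O ≤ 1) (a : m) : ∑ b, ‖O b a‖ ^ 2 ≤ 1 := by
  have h1 := (LinearMap.toContinuousLinearMap (Matrix.toEuclideanLin O)).le_opNorm
    (EuclideanSpace.single a (1 : ℂ))
  have h2 : ‖(LinearMap.toContinuousLinearMap (Matrix.toEuclideanLin O))
    (EuclideanSpace.single a (1 : ℂ))‖ ≤ 1 := by
    refine h1.trans ?_
    simpa [opNorm] using h
  rw [EuclideanSpace.norm_eq] at h2
  rw [Real.sqrt_le_one] at h2
  simpa [Matrix.toLpLin_apply] using h2

theorem opNorm_quad (S : Matrix (Fin 3) (Fin 3) ℝ) (C : ℝ) (h : opNorm S ≤ C) (w : Fin 3 → ℝ) :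
    ∑ i, ∑ j, w i * S i j * w j ≤ C * ∑ i, w i ^ 2 := by
  set x : EuclideanSpace ℝ (Fin 3) := WithLp.toLp 2 w with hx
  have h1 := (LinearMap.toContinuousLinearMap (Matrix.toEuclideanLin S)).le_opNorm x
  have h2 := real_inner_le_norm x ((LinearMap.toContinuousLinearMap (Matrix.toEuclideanLin S)) x)
  have h3 : ‖x‖ ^ 2 = ∑ i, w i ^ 2 := by
    rw [EuclideanSpace.norm_sq_eq]; simp [hx]
  have h4 : inner ℝ x ((LinearMap.toContinuousLinearMap (Matrix.toEuclideanLin S)) x)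
      = ∑ i, ∑ j, w i * S i j * w j := by
    simp [PiLp.inner_apply, hx, Matrix.mulVec, dotProduct, Fin.sum_univ_three]
    ring
  rw [← h4, ← h3]
  have h5 : ‖(LinearMap.toContinuousLinearMap (Matrix.toEuclideanLin S)) x‖ ≤ C * ‖x‖ :=
    h1.trans (mul_le_mul_of_nonneg_right h (norm_nonneg _))
  nlinarith [mul_le_mul_of_nonneg_left h5 (norm_nonneg x)]

def rsg (μ : ℝ) : Fin 2 → ℝ := ![√((1+μ)/2), √((1-μ)/2)]
def gw (μ : ℝ) : Fin 4 → ℝ := ![1, √(1-μ^2), √(1-μ^2), 1]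

theorem completeness1 (μ : ℝ) (h : μ ^ 2 < 1) (a b a' b' : Fin 2) :
    ∑ j, ((gw μ j : ℂ))⁻¹ * ((rsg μ a : ℂ) * (rsg μ b : ℂ)) * biasedBasis μ j b a
      * biasedBasis μ j a' b' = if a = a' ∧ b = b' then 1 else 0 := by
  obtain ⟨h1, h2⟩ := abs_lt.1 ((sq_lt_one_iff_abs_lt_one μ).1 h)
  have hs : 0 < √(1-μ^2) := Real.sqrt_pos.2 (by linarith)
  have hs2 : √(1-μ^2) ^ 2 = 1 - μ^2 := Real.sq_sqrt (by linarith)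
  have hp : √((1+μ)/2) ^ 2 = (1+μ)/2 := Real.sq_sqrt (by linarith)
  have hq : √((1-μ)/2) ^ 2 = (1-μ)/2 := Real.sq_sqrt (by linarith)
  have hpq : √((1+μ)/2) * √((1-μ)/2) = √(1-μ^2) / 2 := by
    rw [← Real.sqrt_mul (by linarith), show (1+μ)/2 * ((1-μ)/2) = (1-μ^2) / 2^2 by ring,
      Real.sqrt_div (by linarith), Real.sqrt_sq (by norm_num)]
  have e0 : rsg μ 0 = √((1+μ)/2) := rfl
  have e1 : rsg μ 1 = √((1-μ)/2) := rfl
  generalize hsd : √(1-μ^2) = s at *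
  generalize √((1+μ)/2) = p at *
  generalize √((1-μ)/2) = q at *
  have hsC : (s : ℂ) ≠ 0 := by exact_mod_cast hs.ne'
  have hs2C : (s : ℂ) ^ 2 = 1 - μ^2 := by exact_mod_cast hs2
  have hpC : (p : ℂ) ^ 2 = (1+μ)/2 := by exact_mod_cast hp
  have hqC : (q : ℂ) ^ 2 = (1-μ)/2 := by exact_mod_cast hq
  have hpqC : (p : ℂ) * q = s/2 := by exact_mod_cast hpq
  fin_cases a <;> fin_cases b <;> fin_cases a' <;> fin_cases b' <;>
    simp [Fin.sum_univ_four, gw, e0, e1, biasedBasis, pauli, Ztilde, hsd] <;> 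
    field_simp
  all_goals
    try rw [mul_comm (q : ℂ) p]
    simp only [hpC, hqC, hpqC, hs2C, Complex.I_sq]
    ring


theorem biased_herm (μ : ℝ) (j : Fin 4) (a b : Fin 2) :
    (starRingEnd ℂ) (biasedBasis μ j a b) = biasedBasis μ j b a := by
  fin_cases j <;> fin_cases a <;> fin_cases b <;>
    simp [biasedBasis, pauli, Ztilde]

theorem completeness (μ : ℝ) (h : μ ^ 2 < 1) {n : ℕ} (a b a' b' : Fin n → Fin 2) :
    ∑ P : Fin n → Fin 4, (∏ i, (gw μ (P i) : ℂ))⁻¹ * (∏ i, ((rsg μ (a i) : ℂ) * (rsg μ (b i) : ℂ)))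
      * tens (fun i => biasedBasis μ (P i)) b a * tens (fun i => biasedBasis μ (P i)) a' b'
      = if a = a' ∧ b = b' then 1 else 0 := by
  simp only [tens, Matrix.of_apply, ← Finset.prod_inv_distrib, ← Finset.prod_mul_distrib]
  have := Fintype.prod_sum (fun (i : Fin n) (j : Fin 4) => ((gw μ j : ℂ))⁻¹ * ((rsg μ (a i) : ℂ) * (rsg μ (b i) : ℂ)) * biasedBasis μ j (b i) (a i)
      * biasedBasis μ j (a' i) (b' i))
  rw [← this]
  simp only [completeness1 μ h]
  rw [Finset.prod_ite_zero]
  simp [funext_iff, forall_and]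

theorem expansion (μ : ℝ) (h : μ ^ 2 < 1) {n : ℕ} (O : Matrix (Fin n → Fin 2) (Fin n → Fin 2) ℂ)
    (hO : O.IsHermitian) : ∃ c : (Fin n → Fin 4) → ℝ,
      (O = ∑ P : Fin n → Fin 4, c P • tens fun i => biasedBasis μ (P i)) ∧
      ∑ P, c P ^ 2 * ∏ i, gw μ (P i)
        = ∑ a, ∑ b, (∏ i, (rsg μ (a i) * rsg μ (b i))) * ‖O a b‖ ^ 2 := by
  set T : (Fin n → Fin 4) → Matrix (Fin n → Fin 2) (Fin n → Fin 2) ℂ :=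
    fun P => tens fun i => biasedBasis μ (P i) with hT
  have hTh : ∀ P a b, (starRingEnd ℂ) (T P a b) = T P b a := by
    intro P a b
    simp [hT, tens, biased_herm]
  set W : (Fin n → Fin 2) → (Fin n → Fin 2) → ℂ :=
    fun a b => ∏ i, ((rsg μ (a i) : ℂ) * (rsg μ (b i) : ℂ)) with hW
  have hWs : ∀ a b, W a b = W b a := by intro a b; simp [hW, mul_comm]
  have hWr : ∀ a b, (starRingEnd ℂ) (W a b) = W a b := by intro a b; simp [hW]
  set G : (Fin n → Fin 4) → ℂ := fun P => ∏ i, (gw μ (P i) : ℂ) with hG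
  have hGr : ∀ P, (starRingEnd ℂ) (G P) = G P := by intro P; simp [hG]
  have hG0 : ∀ P, G P ≠ 0 := by
    intro P
    refine Finset.prod_ne_zero_iff.2 fun i _ => ?_
    have : 0 < √(1 - μ^2) := Real.sqrt_pos.2 (by linarith)
    have h2 : gw μ (P i) ≠ 0 := by
      generalize P i = j
      fin_cases j <;> simp [gw, this.ne']
    exact_mod_cast h2
  have hcomp : ∀ a b a' b', ∑ P, (G P)⁻¹ * W a b * T P b a * T P a' b'
      = if a = a' ∧ b = b' then 1 else 0 := fun a b a' b' => completeness μ h a b a' b'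
  have hOh : ∀ a b, (starRingEnd ℂ) (O a b) = O b a := fun a b => hO.apply b a
  set C : (Fin n → Fin 4) → ℂ := fun P => ∑ a, ∑ b, (G P)⁻¹ * W a b * T P b a * O a b with hC
  have hCr : ∀ P, ((C P).re : ℂ) = C P := by
    intro P
    rw [← Complex.conj_eq_iff_re]
    simp only [hC, map_sum, map_mul, map_inv₀, hGr, hWr, hTh, hOh]
    rw [Finset.sum_comm]
    refine Finset.sum_congr rfl fun a _ => Finset.sum_congr rfl fun b _ => ?_
    rw [hWs]
  have hexp : ∀ a' b', ∑ P, C P * T P a' b' = O a' b' := by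
    intro a' b'
    calc ∑ P, C P * T P a' b' = ∑ P, ∑ a, ∑ b, (G P)⁻¹ * W a b * T P b a * T P a' b' * O a b := by
          simp only [hC, Finset.sum_mul]
          refine Finset.sum_congr rfl fun P _ => Finset.sum_congr rfl fun a _ => Finset.sum_congr rfl fun b _ => ?_
          ring
      _ = ∑ a, ∑ b, (∑ P, (G P)⁻¹ * W a b * T P b a * T P a' b') * O a b := by
          rw [Finset.sum_comm]
          refine Finset.sum_congr rfl fun a _ => ?_
          rw [Finset.sum_comm]
          refine Finset.sum_congr rfl fun b _ => ?_
          rw [Finset.sum_mul]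
      _ = O a' b' := by
          simp only [hcomp]
          rw [Finset.sum_eq_single a', Finset.sum_eq_single b']
          · simp
          · intro b _ hb; simp [hb]
          · simp
          · intro a _ ha; simp [ha]
          · simp
  refine ⟨fun P => (C P).re, ?_, ?_⟩
  · ext a b
    rw [Matrix.sum_apply, ← hexp a b]
    refine Finset.sum_congr rfl fun P _ => ?_
    rw [Matrix.smul_apply, Complex.real_smul, hCr]
  · apply Complex.ofReal_injective
    push_cast
    simp only [hCr]
    calc ∑ P, C P ^ 2 * G P = ∑ P, ∑ a, ∑ b, W a b * O a b * (C P * T P b a) := by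
          refine Finset.sum_congr rfl fun P _ => ?_
          have : C P ^ 2 * G P = (C P * G P) * C P := by ring
          rw [this]
          have hCP : C P = ∑ a, ∑ b, (G P)⁻¹ * W a b * T P b a * O a b := rfl
          conv_lhs => rw [mul_comm]
          conv_lhs => enter [1]; rw [hCP]
          simp only [Finset.sum_mul]
          refine Finset.sum_congr rfl fun a _ => Finset.sum_congr rfl fun b _ => ?_
          have := hG0 P
          field_simp
      _ = ∑ a, ∑ b, W a b * O a b * ∑ P, C P * T P b a := by
          rw [Finset.sum_comm]
          refine Finset.sum_congr rfl fun a _ => ?_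
          rw [Finset.sum_comm]
          refine Finset.sum_congr rfl fun b _ => ?_
          rw [Finset.mul_sum]
      _ = _ := by
          refine Finset.sum_congr rfl fun a _ => Finset.sum_congr rfl fun b _ => ?_
          rw [hexp, ← hOh a b, mul_assoc, Complex.mul_conj, Complex.normSq_eq_norm_sq]
          simp [hW]

theorem weight_bound (μ : ℝ) (h : μ ^ 2 < 1) {n : ℕ} (O : Matrix (Fin n → Fin 2) (Fin n → Fin 2) ℂ)
    (hO : O.IsHermitian) (h1 : opNorm O ≤ 1) :
    ∑ a, ∑ b, (∏ i, (rsg μ (a i) * rsg μ (b i))) * ‖O a b‖ ^ 2 ≤ 1 := by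
  obtain ⟨hm1, hm2⟩ := abs_lt.1 ((sq_lt_one_iff_abs_lt_one μ).1 h)
  set R : (Fin n → Fin 2) → ℝ := fun a => ∏ i, rsg μ (a i) with hR
  have hR2 : ∑ a, R a ^ 2 = 1 := by
    simp only [hR, ← Finset.prod_pow]
    rw [← Fintype.prod_sum (fun (_ : Fin n) (j : Fin 2) => rsg μ j ^ 2)]
    have : ∑ j, rsg μ j ^ 2 = 1 := by
      simp only [Fin.sum_univ_two, rsg, Matrix.cons_val_zero, Matrix.cons_val_one]
      rw [Real.sq_sqrt (by linarith), Real.sq_sqrt (by linarith)]; ring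
    simp [this]
  have hsym : ∀ a b, ‖O a b‖ = ‖O b a‖ := by
    intro a b; rw [← hO.apply a b, norm_star]
  have hhalf : ∑ a, R a ^ 2 * ∑ b, ‖O b a‖ ^ 2 ≤ 1 := by
    rw [← hR2]
    refine Finset.sum_le_sum fun a _ => ?_
    exact mul_le_of_le_one_right (sq_nonneg _) (opNorm_col O h1 a)
  calc _ ≤ ∑ a, ∑ b, ((R a ^ 2 * ‖O b a‖ ^ 2) / 2 + (R b ^ 2 * ‖O a b‖ ^ 2) / 2) := by
        refine Finset.sum_le_sum fun a _ => Finset.sum_le_sum fun b _ => ?_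
        rw [Finset.prod_mul_distrib, hsym b a]
        have : 0 ≤ (R a - R b) ^ 2 * ‖O a b‖ ^ 2 := by positivity
        simp only [hR] at *
        nlinarith
    _ = ∑ a, R a ^ 2 * ∑ b, ‖O b a‖ ^ 2 := by
        simp only [Finset.sum_add_distrib]
        rw [Finset.sum_comm (f := fun a b => (R b ^ 2 * ‖O a b‖ ^ 2) / 2)]
        rw [← Finset.sum_add_distrib]
        refine Finset.sum_congr rfl fun a _ => ?_
        rw [← Finset.sum_add_distrib, Finset.mul_sum]
        refine Finset.sum_congr rfl fun b _ => ?_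
        ring
    _ ≤ 1 := hhalf

theorem single_abstract {E : Type*} [MeasurableSpace E] (D : Measure E) [IsProbabilityMeasure D]
    (x y z : E → ℝ) (hx : Measurable x) (hy : Measurable y) (hz : Measurable z)
    (hp : ∀ᵐ ρ ∂D, x ρ ^ 2 + y ρ ^ 2 + z ρ ^ 2 = 1)
    (μ η : ℝ) (hη0 : 0 < η) (hη1 : η < 1)
    (mx : ∫ ρ, x ρ ∂D = 0) (my : ∫ ρ, y ρ ∂D = 0) (mz : ∫ ρ, z ρ ∂D = μ)
    (hq : ∀ a b c : ℝ, ∫ ρ, (a * x ρ + b * y ρ + c * z ρ) ^ 2 ∂D ≤ (1 - η) * (a^2 + b^2 + c^2))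
    (e : ℝ) (he0 : 0 ≤ e) (he1 : e ≤ η * (1 - √(1 - η / 2)) / (1 - η / 2)) (he2 : e ≤ η / 2) :
    μ ^ 2 ≤ 1 - η ∧ ∀ u0 u1 u2 u3 : ℝ,
      ∫ ρ, (u0 + u1 * x ρ + u2 * y ρ + u3 * ((√(1 - μ^2))⁻¹ * (z ρ - μ))) ^ 2 ∂D
        ≤ u0 ^ 2 + (1 - e) * √(1 - μ^2) * u1 ^ 2 + (1 - e) * √(1 - μ^2) * u2 ^ 2
          + (1 - e) * u3 ^ 2 := by
  have ix : Integrable x D := Integrable.of_bound hx.aestronglyMeasurable 1 (by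
    filter_upwards [hp] with ρ h
    rw [Real.norm_eq_abs, abs_le_one_iff_mul_self_le_one]
    nlinarith [sq_nonneg (x ρ), sq_nonneg (y ρ), sq_nonneg (z ρ)])
  have iy : Integrable y D := Integrable.of_bound hy.aestronglyMeasurable 1 (by
    filter_upwards [hp] with ρ h
    rw [Real.norm_eq_abs, abs_le_one_iff_mul_self_le_one]
    nlinarith [sq_nonneg (x ρ), sq_nonneg (y ρ), sq_nonneg (z ρ)])
  have iz : Integrable z D := Integrable.of_bound hz.aestronglyMeasurable 1 (by
    filter_upwards [hp] with ρ h
    rw [Real.norm_eq_abs, abs_le_one_iff_mul_self_le_one]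
    nlinarith [sq_nonneg (x ρ), sq_nonneg (y ρ), sq_nonneg (z ρ)])
  have iq : ∀ a b c : ℝ, Integrable (fun ρ => (a * x ρ + b * y ρ + c * z ρ) ^ 2) D := by
    intro a b c
    refine Integrable.of_bound (by fun_prop) (a^2+b^2+c^2) ?_
    filter_upwards [hp] with ρ h
    rw [Real.norm_eq_abs, abs_of_nonneg (sq_nonneg _)]
    have : (a^2+b^2+c^2) = (a^2+b^2+c^2) * (x ρ ^ 2 + y ρ ^ 2 + z ρ ^ 2) := by rw [h, mul_one]
    rw [this]
    nlinarith [sq_nonneg (a * y ρ - b * x ρ), sq_nonneg (a * z ρ - c * x ρ),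
      sq_nonneg (b * z ρ - c * y ρ)]
  have il : ∀ a b c : ℝ, Integrable (fun ρ => a * x ρ + b * y ρ + c * z ρ) D := fun a b c =>
    ((ix.const_mul a).add (iy.const_mul b)).add (iz.const_mul c)
  have ml : ∀ a b c : ℝ, ∫ ρ, (a * x ρ + b * y ρ + c * z ρ) ∂D = c * μ := by
    intro a b c
    have i2 : Integrable (fun ρ => a * x ρ + b * y ρ) D := (ix.const_mul a).add (iy.const_mul b)
    rw [integral_add i2 (iz.const_mul c),
      integral_add (ix.const_mul a) (iy.const_mul b)]
    simp only [integral_const_mul, mx, my, mz]; ring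
  -- second moment of affine functions
  have maff : ∀ k a b c : ℝ, ∫ ρ, (k + (a * x ρ + b * y ρ + c * z ρ)) ^ 2 ∂D
      = k ^ 2 + 2 * k * (c * μ) + ∫ ρ, (a * x ρ + b * y ρ + c * z ρ) ^ 2 ∂D := by
    intro k a b c
    have : (fun ρ => (k + (a * x ρ + b * y ρ + c * z ρ)) ^ 2)
      = fun ρ => (k ^ 2 + (2 * k) * (a * x ρ + b * y ρ + c * z ρ))
        + (a * x ρ + b * y ρ + c * z ρ) ^ 2 := by
      funext ρ; ring
    have i2 : Integrable (fun ρ => k ^ 2 + (2 * k) * (a * x ρ + b * y ρ + c * z ρ)) D :=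
      (integrable_const _).add ((il a b c).const_mul _)
    rw [this, integral_add i2 (iq a b c),
      integral_add (integrable_const _) ((il a b c).const_mul _), integral_const_mul, ml]
    simp
  have hmu : μ ^ 2 ≤ 1 - η := by
    have h1 := maff (-μ) 0 0 1
    have h2 : 0 ≤ ∫ ρ, (-μ + (0 * x ρ + 0 * y ρ + 1 * z ρ)) ^ 2 ∂D :=
      integral_nonneg fun ρ => sq_nonneg _
    have h3 := hq 0 0 1
    nlinarith
  refine ⟨hmu, fun u0 u1 u2 u3 => ?_⟩
  have hs0 : 0 < √(1 - μ^2) := Real.sqrt_pos.2 (by linarith)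
  have hs : √(1 - μ^2) ^ 2 = 1 - μ^2 := Real.sq_sqrt (by linarith)
  have hr0 : 0 < √(1 - η/2) := Real.sqrt_pos.2 (by linarith)
  have hr : √(1 - η/2) ^ 2 = 1 - η/2 := Real.sq_sqrt (by linarith)
  generalize √(1 - μ^2) = s at *
  generalize √(1 - η/2) = r at *
  obtain ⟨w, hw⟩ : ∃ w, u3 = w * s := ⟨u3 / s, by field_simp⟩
  have e1 : (fun ρ => (u0 + u1 * x ρ + u2 * y ρ + u3 * (s⁻¹ * (z ρ - μ))) ^ 2)
      = fun ρ => ((u0 - w * μ) + (u1 * x ρ + u2 * y ρ + w * z ρ)) ^ 2 := by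
    funext ρ
    rw [hw]; field_simp; ring
  rw [e1, maff]
  have hV2 : ∫ ρ, (u1 * x ρ + u2 * y ρ + w * z ρ) ^ 2 ∂D - μ ^ 2 * w ^ 2
      ≤ s ^ 2 * ((u1 ^ 2 + u2 ^ 2) + w ^ 2) := by
    have h1 := maff (-(w * μ)) u1 u2 w
    have h2 : ∫ ρ, (-(w * μ) + (u1 * x ρ + u2 * y ρ + w * z ρ)) ^ 2 ∂D
        ≤ ∫ ρ, (u1^2+u2^2+w^2) * ((1 + μ^2) + (0 * x ρ + 0 * y ρ + (-2 * μ) * z ρ)) ∂D := by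
      apply integral_mono_ae
      · have : (fun ρ => (-(w * μ) + (u1 * x ρ + u2 * y ρ + w * z ρ)) ^ 2)
          = fun ρ => ((w * μ) ^ 2 + (2 * (-(w * μ))) * (u1 * x ρ + u2 * y ρ + w * z ρ))
            + (u1 * x ρ + u2 * y ρ + w * z ρ) ^ 2 := by
          funext ρ; ring
        rw [this]
        exact ((integrable_const _).add ((il _ _ _).const_mul _)).add (iq _ _ _)
      · exact ((integrable_const _).add (il _ _ _)).const_mul _
      · filter_upwards [hp] with ρ h
        have : (1 + μ^2) + (0 * x ρ + 0 * y ρ + (-2 * μ) * z ρ)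
          = x ρ ^ 2 + y ρ ^ 2 + (z ρ - μ) ^ 2 := by linarith
        rw [this]
        nlinarith [sq_nonneg (u1 * y ρ - u2 * x ρ), sq_nonneg (u1 * (z ρ - μ) - w * x ρ),
          sq_nonneg (u2 * (z ρ - μ) - w * y ρ)]
    rw [integral_const_mul, integral_add (integrable_const _) (il _ _ _), ml, h1] at h2
    simp at h2
    rw [hs]
    nlinarith
  have := scalar_aux η μ s r e (∫ ρ, (u1 * x ρ + u2 * y ρ + w * z ρ) ^ 2 ∂D - μ ^ 2 * w ^ 2)
    (u1 ^ 2 + u2 ^ 2) (w ^ 2) hη0 hη1 hs0 hs (by linarith) hr0 hr he0 he1 he2 (by positivity)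
    (by positivity) (by linarith [hq u1 u2 w]) hV2
  rw [hw]
  nlinarith

def phf (μ : ℝ) (j : Fin 4) (ρ : Matrix (Fin 2) (Fin 2) ℂ) : ℝ := ((biasedBasis μ j * ρ).trace).re

theorem meas_trace (A : Matrix (Fin 2) (Fin 2) ℂ) :
    Measurable (fun ρ : Matrix (Fin 2) (Fin 2) ℂ => ((A * ρ).trace).re) := by
  have hm : ∀ a b, Measurable (fun ρ : Matrix (Fin 2) (Fin 2) ℂ => ρ a b) :=
    fun a b => (measurable_pi_apply b).comp (measurable_pi_apply a)
  simp only [Matrix.trace, Matrix.diag, Matrix.mul_apply, Fin.sum_univ_two]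
  fun_prop

theorem phf_real (μ : ℝ) (j : Fin 4) (ρ : Matrix (Fin 2) (Fin 2) ℂ) (h : ρ.IsHermitian) :
    (biasedBasis μ j * ρ).trace = (phf μ j ρ : ℂ) := by
  symm
  rw [phf, ← Complex.conj_eq_iff_re]
  simp only [Matrix.trace, Matrix.diag, Matrix.mul_apply, map_sum, map_mul, biased_herm]
  rw [Finset.sum_comm]
  refine Finset.sum_congr rfl fun a _ => Finset.sum_congr rfl fun b _ => ?_
  congr 1
  exact h.apply _ _

theorem pauli_tr0 (ρ : Matrix (Fin 2) (Fin 2) ℂ) : (pauli 0 * ρ).trace = ρ 1 0 + ρ 0 1 := by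
  simp only [Matrix.trace_fin_two, Matrix.mul_apply, Fin.sum_univ_two]
  simp [pauli]

theorem pauli_tr1 (ρ : Matrix (Fin 2) (Fin 2) ℂ) :
    (pauli 1 * ρ).trace = -Complex.I * ρ 1 0 + Complex.I * ρ 0 1 := by
  simp only [Matrix.trace_fin_two, Matrix.mul_apply, Fin.sum_univ_two]
  simp [pauli]

theorem pauli_tr2 (ρ : Matrix (Fin 2) (Fin 2) ℂ) : (pauli 2 * ρ).trace = ρ 0 0 - ρ 1 1 := by
  simp only [Matrix.trace_fin_two, Matrix.mul_apply, Fin.sum_univ_two]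
  simp [pauli, sub_eq_add_neg]

theorem pure_coords (ρ : Matrix (Fin 2) (Fin 2) ℂ) (h : ρ.IsHermitian) (ht : ρ.trace = 1)
    (hr : ρ.rank = 1) :
    (ρ 0 0).im = 0 ∧ (ρ 1 1).im = 0 ∧ (ρ 1 0).re = (ρ 0 1).re ∧ (ρ 1 0).im = - (ρ 0 1).im ∧
    (ρ 1 1).re = 1 - (ρ 0 0).re ∧
    (ρ 0 0).re * (1 - (ρ 0 0).re) = (ρ 0 1).re ^ 2 + (ρ 0 1).im ^ 2 := by
  have hd : ρ.det = 0 := by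
    by_contra h0
    have := Matrix.rank_of_isUnit ρ ((Matrix.isUnit_iff_isUnit_det _).2 (isUnit_iff_ne_zero.2 h0))
    rw [hr] at this; simp at this
  have h00 := h.apply 0 0
  have h01 := h.apply 0 1
  have h11 := h.apply 1 1
  rw [Matrix.det_fin_two] at hd
  rw [Matrix.trace_fin_two] at ht
  simp only [Complex.ext_iff, Complex.star_def, Complex.conj_re, Complex.conj_im, Complex.add_re,
    Complex.add_im, Complex.one_re, Complex.one_im, Complex.sub_re, Complex.sub_im,
    Complex.mul_re, Complex.mul_im, Complex.zero_re, Complex.zero_im] at *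
  obtain ⟨_, a⟩ := h00
  obtain ⟨b, c⟩ := h01
  obtain ⟨_, e⟩ := h11
  obtain ⟨f, _⟩ := hd
  have a0 : (ρ 0 0).im = 0 := by linarith
  have e0 : (ρ 1 1).im = 0 := by linarith
  have c' : (ρ 1 0).im = - (ρ 0 1).im := by linarith
  have t1 : (ρ 1 1).re = 1 - (ρ 0 0).re := by linarith [ht.1]
  rw [a0, e0, b, c', t1] at f
  exact ⟨a0, e0, b, c', t1, by linarith⟩

theorem pure_bloch (ρ : Matrix (Fin 2) (Fin 2) ℂ) (h : ρ.IsHermitian) (ht : ρ.trace = 1)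
    (hr : ρ.rank = 1) :
    ((pauli 0 * ρ).trace).re ^ 2 + ((pauli 1 * ρ).trace).re ^ 2
      + ((pauli 2 * ρ).trace).re ^ 2 = 1 := by
  obtain ⟨a, b, c, d, e, f⟩ := pure_coords ρ h ht hr
  rw [pauli_tr0, pauli_tr1, pauli_tr2]
  simp [c, d, e]
  linarith

theorem pure_entry (ρ : Matrix (Fin 2) (Fin 2) ℂ) (h : ρ.IsHermitian) (ht : ρ.trace = 1)
    (hr : ρ.rank = 1) (i j : Fin 2) : ‖ρ i j‖ ≤ 1 := by
  obtain ⟨a, b, c, d, e, f⟩ := pure_coords ρ h ht hr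
  rw [← sq_le_one_iff₀ (norm_nonneg _), ← Complex.normSq_eq_norm_sq, Complex.normSq_apply]
  fin_cases i <;> fin_cases j <;> simp only [Fin.zero_eta, Fin.mk_one, a, b, c, d, e] <;>
    nlinarith [sq_nonneg (ρ 0 1).re, sq_nonneg (ρ 0 1).im, sq_nonneg ((ρ 0 0).re - 1/2)]

theorem phf_vals (μ : ℝ) (ρ : Matrix (Fin 2) (Fin 2) ℂ) (ht : ρ.trace = 1) :
    phf μ 0 ρ = 1 ∧ phf μ 1 ρ = ((pauli 0 * ρ).trace).re ∧ phf μ 2 ρ = ((pauli 1 * ρ).trace).re ∧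
    phf μ 3 ρ = (√(1 - μ^2))⁻¹ * (((pauli 2 * ρ).trace).re - μ) := by
  refine ⟨by simp [phf, biasedBasis, ht], rfl, rfl, ?_⟩
  have : biasedBasis μ 3 = (√(1 - μ^2))⁻¹ • (pauli 2 - (μ : ℂ) • 1) := rfl
  rw [phf, this, Matrix.smul_mul, Matrix.trace_smul, Matrix.sub_mul, Matrix.trace_sub,
    Matrix.smul_mul, Matrix.one_mul, Matrix.trace_smul, ht]
  simp

theorem L_eq (μ e : ℝ) (j : Fin 4) :
    (![1, (1 - e) * √(1 - μ^2), (1 - e) * √(1 - μ^2), 1 - e] : Fin 4 → ℝ) j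
      = gw μ j * (if j ≠ 0 then 1 - e else 1) := by
  fin_cases j <;> simp [gw, mul_comm]

/-- low-degree approximation, quantum case.
Let `η ∈ (0,1)` and `D` a distribution over single-qubit pure states whose Pauli second
moment matrix has operator norm at most `1-η` and whose mean state is `½(I + μZ)`.
For any `2ⁿ×2ⁿ` Hermitian `O` with `‖O‖_op ≤ 1` and any `d ≥ 0` there is an element
`O^{≤d}` of the real span of tensor products of `{I,X,Y,Z̃}` with at most `d`
non-identity factors such that
`E_{ρ ∼ D^{⊗n}}[(tr(O ρ₁⊗⋯⊗ρ_n) - tr(O^{≤d} ρ₁⊗⋯⊗ρ_n))²] ≤ (1-η')^d`,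
where `η' = min{η(1-√(1-η/2))/(1-η/2), η/2}`. -/
theorem quantum_low_degree_approximation
    (n : ℕ) (η : ℝ) (hη : η ∈ Set.Ioo (0 : ℝ) 1)
    (D : Measure (Matrix (Fin 2) (Fin 2) ℂ)) [IsProbabilityMeasure D]
    (hpure : ∀ᵐ ρ ∂D, ρ.PosSemidef ∧ ρ.trace = 1 ∧ ρ.rank = 1)
    (hmoment : opNorm (pauliSecondMoment D) ≤ 1 - η)
    (μ : ℝ)
    (hmean : ∀ i j : Fin 2,
      ∫ ρ, ρ i j ∂D
        = ((1 / 2 : ℂ) • (1 + (μ : ℂ) • (!![1, 0; 0, -1] : Matrix (Fin 2) (Fin 2) ℂ))) i j)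
    (O : Matrix (Fin n → Fin 2) (Fin n → Fin 2) ℂ)
    (hO : O.IsHermitian) (hOnorm : opNorm O ≤ 1) (d : ℕ) :
    ∃ c : (Fin n → Fin 4) → ℝ,
      (∀ P : Fin n → Fin 4,
          d < (Finset.univ.filter fun i => P i ≠ 0).card → c P = 0) ∧
      ∫ ρ, (((O * tens ρ).trace).re -
            (((∑ P : Fin n → Fin 4, c P • tens fun i => biasedBasis μ (P i)) *
                tens ρ).trace).re) ^ 2
          ∂(Measure.pi fun _ : Fin n => D)
        ≤ (1 - min (η * (1 - Real.sqrt (1 - η / 2)) / (1 - η / 2)) (η / 2)) ^ d := by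
  obtain ⟨hη0, hη1⟩ := hη
  set e := min (η * (1 - Real.sqrt (1 - η / 2)) / (1 - η / 2)) (η / 2) with he
  have he0 : 0 ≤ e := by
    refine le_min (div_nonneg (mul_nonneg hη0.le ?_) (by linarith)) (by linarith)
    have : √(1 - η/2) ≤ 1 := by rw [Real.sqrt_le_one]; linarith
    linarith
  have he1 := min_le_left (η * (1 - Real.sqrt (1 - η / 2)) / (1 - η / 2)) (η / 2)
  have he2 := min_le_right (η * (1 - Real.sqrt (1 - η / 2)) / (1 - η / 2)) (η / 2)
  rw [← he] at he1 he2
  set p : Fin 3 → Matrix (Fin 2) (Fin 2) ℂ → ℝ := fun i ρ => ((pauli i * ρ).trace).re with hpdef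
  have mp : ∀ i, Measurable (p i) := fun i => meas_trace _
  have hb : ∀ᵐ ρ ∂D, p 0 ρ ^ 2 + p 1 ρ ^ 2 + p 2 ρ ^ 2 = 1 := by
    filter_upwards [hpure] with ρ h using pure_bloch ρ h.1.1 h.2.1 h.2.2
  have hpb : ∀ i, ∀ᵐ ρ ∂D, |p i ρ| ≤ 1 := by
    intro i
    filter_upwards [hb] with ρ h
    rw [abs_le_one_iff_mul_self_le_one]
    fin_cases i <;> simp only [Fin.zero_eta, Fin.mk_one, Fin.reduceFinMk] <;>
    nlinarith [sq_nonneg (p 0 ρ), sq_nonneg (p 1 ρ), sq_nonneg (p 2 ρ)]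
  have ipp : ∀ i j, Integrable (fun ρ => p i ρ * p j ρ) D := by
    intro i j
    refine Integrable.of_bound ((mp i).mul (mp j)).aestronglyMeasurable 1 ?_
    filter_upwards [hpb i, hpb j] with ρ h1 h2
    rw [norm_mul]
    exact mul_le_one₀ h1 (abs_nonneg _) h2
  have hq : ∀ a b c : ℝ, ∫ ρ, (a * p 0 ρ + b * p 1 ρ + c * p 2 ρ) ^ 2 ∂D
      ≤ (1 - η) * (a^2 + b^2 + c^2) := by
    intro a b c
    have h1 := opNorm_quad _ _ hmoment ![a, b, c]
    have h2 : ∫ ρ, (a * p 0 ρ + b * p 1 ρ + c * p 2 ρ) ^ 2 ∂D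
        = ∑ i, ∑ j, ![a, b, c] i * pauliSecondMoment D i j * ![a, b, c] j := by
      have : (fun ρ => (a * p 0 ρ + b * p 1 ρ + c * p 2 ρ) ^ 2)
          = fun ρ => ∑ i, ∑ j, (![a, b, c] i * ![a, b, c] j) * (p i ρ * p j ρ) := by
        funext ρ
        simp [Fin.sum_univ_three]; ring
      rw [this, integral_finsetSum _ fun i _ => integrable_finsetSum _ fun j _ =>
        (ipp i j).const_mul _]
      refine Finset.sum_congr rfl fun i _ => ?_
      rw [integral_finsetSum _ fun j _ => (ipp i j).const_mul _]
      refine Finset.sum_congr rfl fun j _ => ?_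
      rw [integral_const_mul]
      have : pauliSecondMoment D i j = ∫ ρ, p i ρ * p j ρ ∂D := rfl
      rw [this]; ring
    rw [h2]
    refine h1.trans (le_of_eq ?_)
    simp [Fin.sum_univ_three]
  -- means
  have hm : ∀ a b, Measurable (fun ρ : Matrix (Fin 2) (Fin 2) ℂ => ρ a b) :=
    fun a b => (measurable_pi_apply b).comp (measurable_pi_apply a)
  have ient : ∀ a b, Integrable (fun ρ : Matrix (Fin 2) (Fin 2) ℂ => ρ a b) D := by
    intro a b
    refine Integrable.of_bound (hm a b).aestronglyMeasurable 1 ?_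
    filter_upwards [hpure] with ρ h using pure_entry ρ h.1.1 h.2.1 h.2.2 a b
  have hmp : ∀ i, ∫ ρ, p i ρ ∂D = ((pauli i * ((1 / 2 : ℂ) •
      (1 + (μ : ℂ) • (!![1, 0; 0, -1] : Matrix (Fin 2) (Fin 2) ℂ)))).trace).re := by
    intro i
    simp only [hpdef]
    have hi : Integrable (fun ρ => (pauli i * ρ).trace) D := by
      simp only [Matrix.trace, Matrix.diag, Matrix.mul_apply]
      exact integrable_finsetSum _ fun a _ => integrable_finsetSum _ fun b _ =>
        (ient b a).const_mul _
    have h1 : ∫ ρ, ((pauli i * ρ).trace).re ∂D = (∫ ρ, (pauli i * ρ).trace ∂D).re :=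
      integral_re hi
    rw [h1]
    congr 1
    simp only [Matrix.trace, Matrix.diag, Matrix.mul_apply]
    rw [integral_finsetSum Finset.univ fun a _ => integrable_finsetSum Finset.univ fun b _ =>
        (ient b a).const_mul (pauli i a b)]
    refine Finset.sum_congr rfl fun a _ => ?_
    rw [integral_finsetSum _ fun b _ => (ient b a).const_mul _]
    refine Finset.sum_congr rfl fun b _ => ?_
    rw [integral_const_mul, hmean]
  have mx : ∫ ρ, p 0 ρ ∂D = 0 := by
    rw [hmp, pauli_tr0]; simp
  have my : ∫ ρ, p 1 ρ ∂D = 0 := by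
    rw [hmp, pauli_tr1]; simp
  have mz : ∫ ρ, p 2 ρ ∂D = μ := by
    rw [hmp, pauli_tr2]; simp; ring
  obtain ⟨hmu, hform⟩ := single_abstract D (p 0) (p 1) (p 2) (mp 0) (mp 1) (mp 2) hb μ η hη0 hη1
    mx my mz hq e he0 he1 he2
  have hmu1 : μ ^ 2 < 1 := by linarith
  obtain ⟨c0, hexp, hpars⟩ := expansion μ hmu1 O hO
  have hw : ∑ P, c0 P ^ 2 * ∏ i, gw μ (P i) ≤ 1 := by
    rw [hpars]; exact weight_bound μ hmu1 O hO hOnorm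
  set L : Fin 4 → ℝ := ![1, (1 - e) * √(1 - μ^2), (1 - e) * √(1 - μ^2), 1 - e] with hLdef
  have hgw0 : ∀ j, 0 ≤ gw μ j := by
    intro j; fin_cases j <;> simp [gw]
  have hL : ∀ j, 0 ≤ L j := by
    intro j
    rw [hLdef, L_eq]
    refine mul_nonneg (hgw0 j) ?_
    split_ifs <;> linarith
  have hphb : ∀ j, ∀ᵐ ρ ∂D, |phf μ j ρ| ≤ 1 + (√(1 - μ^2))⁻¹ * (1 + |μ|) := by
    intro j
    have hC : 0 ≤ (√(1 - μ^2))⁻¹ * (1 + |μ|) := by positivity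
    filter_upwards [hpure, hpb 0, hpb 1, hpb 2] with ρ h h0 h1 h2
    obtain ⟨v0, v1, v2, v3⟩ := phf_vals μ ρ h.2.1
    fin_cases j <;> simp only [Fin.zero_eta, Fin.mk_one, Fin.reduceFinMk]
    · rw [v0, abs_one]; linarith
    · rw [v1]; exact h0.trans (by linarith)
    · rw [v2]; exact h1.trans (by linarith)
    · rw [v3, abs_mul, abs_of_nonneg (inv_nonneg.2 (Real.sqrt_nonneg _))]
      have : |p 2 ρ - μ| ≤ 1 + |μ| := (abs_sub _ _).trans (by linarith)
      have := mul_le_mul_of_nonneg_left this (inv_nonneg.2 (Real.sqrt_nonneg (1 - μ^2)))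
      simp only [hpdef] at this
      linarith
  have hphph : ∀ j k, Integrable (fun ρ => phf μ j ρ * phf μ k ρ) D := by
    intro j k
    refine Integrable.of_bound (((meas_trace _).mul (meas_trace _)).aestronglyMeasurable)
      ((1 + (√(1 - μ^2))⁻¹ * (1 + |μ|)) * (1 + (√(1 - μ^2))⁻¹ * (1 + |μ|))) ?_
    filter_upwards [hphb j, hphb k] with ρ h1 h2
    rw [norm_mul]
    exact mul_le_mul h1 h2 (abs_nonneg _) ((abs_nonneg _).trans h1)
  have h1 : ∀ u : Fin 4 → ℝ, ∫ ρ, (∑ j, u j * phf μ j ρ) ^ 2 ∂D ≤ ∑ j, L j * u j ^ 2 := by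
    intro u
    have h := hform (u 0) (u 1) (u 2) (u 3)
    have h2 : ∫ ρ, (∑ j, u j * phf μ j ρ) ^ 2 ∂D = ∫ ρ, (u 0 + u 1 * p 0 ρ + u 2 * p 1 ρ +
        u 3 * ((√(1 - μ^2))⁻¹ * (p 2 ρ - μ))) ^ 2 ∂D := by
      refine integral_congr_ae ?_
      filter_upwards [hpure] with ρ h
      obtain ⟨v0, v1, v2, v3⟩ := phf_vals μ ρ h.2.1
      rw [Fin.sum_univ_four, v0, v1, v2, v3, mul_one]
    rw [h2]
    refine h.trans (le_of_eq ?_)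
    simp [Fin.sum_univ_four, hLdef]
  classical
  set wt : (Fin n → Fin 4) → ℕ := fun P => (Finset.univ.filter fun i => P i ≠ 0).card with hwt
  have hLprod : ∀ P : Fin n → Fin 4, ∏ i, L (P i) = (∏ i, gw μ (P i)) * (1 - e) ^ (wt P) := by
    intro P
    simp only [hLdef, L_eq, Finset.prod_mul_distrib]
    congr 1
    rw [Finset.prod_ite]
    simp [hwt]
  refine ⟨fun P => if d < wt P then 0 else c0 P, fun P hP => if_pos hP, ?_⟩
  set c1 : (Fin n → Fin 4) → ℝ := fun P => if d < wt P then c0 P else 0 with hc1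
  have hae : ∀ᵐ ρ ∂(Measure.pi fun _ : Fin n => D), ∀ i, (ρ i).PosSemidef := by
    rw [ae_all_iff]
    intro i
    refine (Measure.tendsto_eval_ae_ae (μ := fun _ : Fin n => D) (i := i)).eventually ?_
    filter_upwards [hpure] with ρ h using h.1
  have htr : ∀ (c : (Fin n → Fin 4) → ℝ) (ρ : Fin n → Matrix (Fin 2) (Fin 2) ℂ),
      (∀ i, (ρ i).PosSemidef) →
      (((∑ P : Fin n → Fin 4, c P • tens fun i => biasedBasis μ (P i)) * tens ρ).trace).re
        = ∑ P, c P * ∏ i, phf μ (P i) (ρ i) := by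
    intro c ρ hρ
    rw [Matrix.sum_mul, Matrix.trace_sum, Complex.re_sum]
    refine Finset.sum_congr rfl fun P _ => ?_
    rw [Matrix.smul_mul, Matrix.trace_smul, trace_tens]
    simp only [fun i => phf_real μ (P i) (ρ i) (hρ i).1]
    rw [← Complex.ofReal_prod, Complex.real_smul, ← Complex.ofReal_mul, Complex.ofReal_re]
  have heq : ∫ ρ, (((O * tens ρ).trace).re -
            (((∑ P : Fin n → Fin 4, (if d < wt P then 0 else c0 P) •
              tens fun i => biasedBasis μ (P i)) * tens ρ).trace).re) ^ 2
          ∂(Measure.pi fun _ : Fin n => D)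
      = ∫ ρ : Fin n → Matrix (Fin 2) (Fin 2) ℂ, (∑ P, c1 P * ∏ i, phf μ (P i) (ρ i)) ^ 2
          ∂(Measure.pi fun _ : Fin n => D) := by
    refine integral_congr_ae ?_
    filter_upwards [hae] with ρ hρ
    rw [htr _ ρ hρ]
    conv_lhs => rw [hexp]
    rw [htr _ ρ hρ, ← Finset.sum_sub_distrib]
    congr 1
    refine Finset.sum_congr rfl fun P _ => ?_
    simp only [hc1]
    split_ifs <;> ring
  have hl0 : 0 ≤ 1 - e := by linarith
  have hl1 : 1 - e ≤ 1 := by linarith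
  calc _ = _ := heq
    _ ≤ ∑ P, c1 P ^ 2 * ∏ i, L (P i) := tensor_bound D (phf μ) hphph L hL h1 n c1
    _ ≤ ∑ P, (1 - e) ^ d * (c0 P ^ 2 * ∏ i, gw μ (P i)) := by
        refine Finset.sum_le_sum fun P _ => ?_
        have hg : 0 ≤ c0 P ^ 2 * ∏ i, gw μ (P i) :=
          mul_nonneg (sq_nonneg _) (Finset.prod_nonneg fun i _ => hgw0 _)
        rw [hLprod]
        simp only [hc1]
        split_ifs with hd
        · have := mul_le_mul_of_nonneg_right (pow_le_pow_of_le_one hl0 hl1 hd.le) hg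
          linarith
        · have := mul_nonneg (pow_nonneg hl0 d) hg
          simpa using this
    _ = (1 - e) ^ d * ∑ P, c0 P ^ 2 * ∏ i, gw μ (P i) := by rw [Finset.mul_sum]
    _ ≤ (1 - e) ^ d := mul_le_of_le_one_right (pow_nonneg hl0 d) hw

end
end

section
/- Let 0 < a < b be real numbers, let d ≥ 1, and let g be a real polynomial of degree exactly d with leading coefficient c ≠ 0. Then sup_{t ∈ [a,b]} |g(t)| ≥ 2·|c|·((b−a)/4)^d. -/
/-- Chebyshev-type extremal bound on an interval.
Let `0 < a < b`, `d ≥ 1`, and let `g` be a real polynomial of degree exactly `d` with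
leading coefficient `c ≠ 0`.  Then `sup_{t ∈ [a,b]} |g t| ≥ 2 |c| ((b-a)/4)^d`. -/
theorem chebyshev_extremal_lower_bound
    (a b : ℝ) (ha : 0 < a) (hab : a < b) (d : ℕ) (hd : 1 ≤ d)
    (g : Polynomial ℝ) (c : ℝ) (hdeg : g.degree = d) (hc : g.coeff d = c) (hc0 : c ≠ 0) :
    2 * |c| * ((b - a) / 4) ^ d ≤ sSup ((fun t => |g.eval t|) '' Set.Icc a b) := by
  have hbdd : BddAbove ((fun t => |g.eval t|) '' Set.Icc a b) :=
    (isCompact_Icc.image (by fun_prop)).bddAbove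
  set M := sSup ((fun t => |g.eval t|) '' Set.Icc a b) with hM
  have hle : ∀ t ∈ Set.Icc a b, |g.eval t| ≤ M := fun t ht =>
    le_csSup hbdd ⟨t, ht, rfl⟩
  have hM0 : 0 ≤ M := (abs_nonneg _).trans (hle a ⟨le_rfl, hab.le⟩)
  refine le_of_forall_pos_le_add fun ε hε => ?_
  have hN : 0 < M + ε := by linarith
  have hnd : g.natDegree = d := Polynomial.natDegree_eq_of_degree_eq_some hdeg
  have hlc : g.leadingCoeff = c := by rw [Polynomial.leadingCoeff, hnd, hc]
  have hba : (b - a) / 2 ≠ 0 := by linarith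
  set L : Polynomial ℝ := Polynomial.C ((b - a) / 2) * Polynomial.X + Polynomial.C ((a + b) / 2)
    with hL
  have hLd : L.natDegree = 1 := Polynomial.natDegree_linear hba
  have hLl : L.leadingCoeff = (b - a) / 2 := Polynomial.leadingCoeff_linear hba
  have key := Polynomial.Chebyshev.leadingCoeff_le_of_forall_abs_le_one (n := d)
    (P := Polynomial.C (|c| / c / (M + ε)) * g.comp L) ?_ ?_
  · rw [Polynomial.leadingCoeff_mul, Polynomial.leadingCoeff_C,
      Polynomial.leadingCoeff_comp (by rw [hLd]; exact one_ne_zero), hlc, hLl, hnd] at key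
    have e : |c| / c / (M + ε) * (c * ((b - a) / 2) ^ d)
        = |c| * ((b - a) / 2) ^ d / (M + ε) := by
      field_simp
    rw [e, div_le_iff₀ hN] at key
    obtain ⟨k, rfl⟩ : ∃ k, d = k + 1 := ⟨d - 1, by omega⟩
    have e2 : (b - a) / 4 = (b - a) / 2 / 2 := by ring
    rw [e2, div_pow _ (2 : ℝ), mul_div_assoc', div_le_iff₀ (by positivity), pow_succ (2 : ℝ)]
    simp only [Nat.add_sub_cancel] at key
    linarith
  · refine Polynomial.degree_le_of_natDegree_le ?_
    refine (Polynomial.natDegree_C_mul_le _ _).trans ?_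
    rw [Polynomial.natDegree_comp, hnd, hLd, mul_one]
  · intro x hx
    have hx' : -1 ≤ x ∧ x ≤ 1 := by simpa [abs_le] using hx
    have hy : L.eval x ∈ Set.Icc a b := by
      simp only [hL, Polynomial.eval_add, Polynomial.eval_mul, Polynomial.eval_C,
        Polynomial.eval_X, Set.mem_Icc]
      constructor <;> nlinarith
    have := hle _ hy
    rw [Polynomial.eval_mul, Polynomial.eval_C, Polynomial.eval_comp, abs_mul, abs_div, abs_div,
      abs_abs, div_self (abs_ne_zero.mpr hc0), abs_of_pos hN, one_div_mul_eq_div,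
      div_le_one hN]
    linarith
end

section
/- For odd n, let f_n : ℝⁿ → ℝ be the unique multilinear polynomial agreeing with the majority function Maj_n(x) = sign(x₁ + ⋯ + x_n) on {−1,1}ⁿ, and for d ≥ 0 let f_n^{≤d} be the sum of the monomial terms of f_n of total degree at most d. Then for all fixed real numbers 0 < a < b < 1 there exists δ ∈ (0,1) such that for every C > 0 there exists n₀ with the following property: for every odd n ≥ n₀ there exists t ∈ [a,b] such that |f_n^{≤⌊δn⌋}(t, t, …, t)| ≥ C. -/
open Polynomial in
lemma maj_trunc_aux {ι : Type*} (s : Finset ι) (e : ι → ℕ) (v : ι → ℝ) (d : ℕ) (t : ℝ) :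
    ∑ k ∈ Finset.range (d+1), (∑ i ∈ s, monomial (e i) (v i)).coeff k * t ^ k
      = ∑ i ∈ s.filter (fun i => e i ≤ d), v i * t ^ (e i) := by
  simp only [finsetSum_coeff, coeff_monomial, Finset.sum_mul]
  rw [Finset.sum_comm, Finset.sum_filter]
  refine Finset.sum_congr rfl fun i _ => ?_
  simp only [ite_mul, zero_mul, Finset.sum_ite_eq, Finset.mem_range]
  simp

lemma maj_alt_aux (T : ℕ → ℝ) (J : ℕ) (h0 : 0 ≤ T 0) (h : ∀ j < J, 2 * T j ≤ T (j+1)) :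
    2 ^ J * T 0 ≤ T J ∧ T J / 2 ≤ (-1)^J * ∑ j ∈ Finset.range (J+1), (-1)^j * T j ∧
      (-1)^J * ∑ j ∈ Finset.range (J+1), (-1)^j * T j ≤ T J := by
  induction J with
  | zero => simp; linarith
  | succ J ih =>
    obtain ⟨h1, h2, h3⟩ := ih (fun j hj => h j (by omega))
    have h4 := h J (by omega)
    have h5 : (0:ℝ) ≤ 2 ^ J * T 0 := by positivity
    have e : (-1:ℝ)^(J+1) * ∑ j ∈ Finset.range (J+1+1), (-1)^j * T j
        = T (J+1) - (-1)^J * ∑ j ∈ Finset.range (J+1), (-1)^j * T j := by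
      rw [Finset.sum_range_succ, mul_add, ← mul_assoc, ← mul_pow]
      simp [pow_succ]; ring
    rw [e]
    refine ⟨?_, ?_, ?_⟩
    · rw [pow_succ]; linarith
    · linarith
    · linarith

open Polynomial in
lemma maj_bern_deriv (n M : ℕ) :
    derivative (∑ k ∈ Finset.range (M+1), bernsteinPolynomial ℝ (n+1) k)
      = - ((n:ℝ[X])+1) * bernsteinPolynomial ℝ n M := by
  induction M with
  | zero => simp [bernsteinPolynomial.derivative_zero]
  | succ M ih =>
    rw [Finset.sum_range_succ, derivative_add, ih, bernsteinPolynomial.derivative_succ]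
    simp; ring

/-- expectation of the multilinear polynomial under a biased product distribution -/
lemma maj_expect (n : ℕ) (c : Finset (Fin n) → ℝ) (t : ℝ) :
    ∑ S : Finset (Fin n), c S * t ^ S.card
      = ∑ A : Finset (Fin n), ((1+t)/2)^A.card * ((1-t)/2)^(n - A.card) *
          ∑ S : Finset (Fin n), c S * ∏ i ∈ S, (if i ∈ A then (1:ℝ) else -1) := by
  simp only [Finset.mul_sum]
  rw [Finset.sum_comm]
  refine Finset.sum_congr rfl fun S _ => ?_
  have key : ∏ i : Fin n, (((1+t)/2) + ((1-t)/2) * (if i ∈ S then -1 else 1)) = t ^ S.card := by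
    have : ∀ i : Fin n, (((1+t)/2) + ((1-t)/2) * (if i ∈ S then (-1:ℝ) else 1))
        = if i ∈ S then t else 1 := by
      intro i; split_ifs <;> ring
    simp only [this]
    rw [Finset.prod_ite]; simp
  rw [← key, Finset.prod_add, Finset.mul_sum, Finset.powerset_univ]
  refine Finset.sum_congr rfl fun A _ => ?_
  have h2 : ∏ i ∈ S, (if i ∈ A then (1:ℝ) else -1)
      = ∏ i ∈ Finset.univ \ A, (if i ∈ S then (-1:ℝ) else 1) := by
    rw [Finset.prod_ite, Finset.prod_ite]
    simp only [Finset.prod_const_one, one_mul, mul_one, Finset.prod_const]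
    congr 2
    ext i; simp [and_comm]
  rw [h2, Finset.prod_mul_distrib]
  simp only [Finset.prod_const, Finset.card_sdiff_of_subset (Finset.subset_univ A), Finset.card_univ, Fintype.card_fin]
  ring

lemma maj_sum_sign (n : ℕ) (A : Finset (Fin n)) :
    ∑ i, (if i ∈ A then (1:ℝ) else -1) = 2 * A.card - n := by
  have : ∀ i, (if i ∈ A then (1:ℝ) else -1) = 2 * (if i ∈ A then (1:ℝ) else 0) - 1 := by
    intro i; split_ifs <;> norm_num
  simp only [this, Finset.sum_sub_distrib, ← Finset.mul_sum]
  simp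

lemma maj_eval (m : ℕ) (c : Finset (Fin (2*m+1)) → ℝ)
    (hc : ∀ x : Fin (2*m+1) → ℝ, (∀ i, x i = 1 ∨ x i = -1) →
          (∑ S : Finset (Fin (2*m+1)), c S * ∏ i ∈ S, x i)
            = if 0 < ∑ i, x i then 1 else -1) (t : ℝ) :
    ∑ S : Finset (Fin (2*m+1)), c S * t ^ S.card
      = 1 - 2 * ∑ k ∈ Finset.range (m+1),
          ((2*m+1).choose k : ℝ) * ((1+t)/2)^k * (1 - (1+t)/2)^(2*m+1-k) := by
  rw [maj_expect]
  have h1 : ∀ A : Finset (Fin (2*m+1)),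
      ∑ S : Finset (Fin (2*m+1)), c S * ∏ i ∈ S, (if i ∈ A then (1:ℝ) else -1)
        = 1 - 2 * (if A.card < m+1 then 1 else 0) := by
    intro A
    rw [hc _ (fun i => by split_ifs <;> simp), maj_sum_sign]
    by_cases h : A.card < m + 1
    · have : (A.card : ℝ) ≤ m := by exact_mod_cast Nat.lt_succ_iff.mp h
      rw [if_pos h, if_neg (by push_cast; linarith)]; norm_num
    · have : (m:ℝ) + 1 ≤ A.card := by exact_mod_cast not_lt.mp h
      rw [if_neg h, if_pos (by push_cast; linarith)]; norm_num
  simp only [h1]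
  have h2 := Finset.sum_powerset_apply_card (x := (Finset.univ : Finset (Fin (2*m+1)))) (fun k => ((1+t)/2)^k * ((1-t)/2)^((2*m+1) - k) *
    (1 - 2 * (if k < m+1 then (1:ℝ) else 0)))
  rw [Finset.powerset_univ] at h2
  rw [h2]
  simp only [Finset.card_univ, Fintype.card_fin, nsmul_eq_mul]
  have h3 := add_pow ((1+t)/2) ((1-t)/2) (2*m+1)
  rw [show (1+t)/2 + (1-t)/2 = 1 by ring, one_pow] at h3
  rw [eq_sub_iff_add_eq, Finset.mul_sum]
  refine Eq.trans ?_ h3.symm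
  have h4 : Finset.range (m+1) = (Finset.range (2*m+1+1)).filter (· < m+1) := by
    ext k; simp; omega
  rw [h4, Finset.sum_filter, ← Finset.sum_add_distrib]
  refine Finset.sum_congr rfl fun k _ => ?_
  rw [show 1 - (1+t)/2 = (1-t)/2 by ring]
  split_ifs <;> ring

open Polynomial in
lemma maj_poly (m : ℕ) (c : Finset (Fin (2*m+1)) → ℝ)
    (hc : ∀ x : Fin (2*m+1) → ℝ, (∀ i, x i = 1 ∨ x i = -1) →
          (∑ S : Finset (Fin (2*m+1)), c S * ∏ i ∈ S, x i)
            = if 0 < ∑ i, x i then 1 else -1) :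
    (∑ S : Finset (Fin (2*m+1)), monomial S.card (c S) : ℝ[X])
      = ∑ j ∈ Finset.range (m+1), monomial (2*j+1)
          ((2*m+1) * (m.centralBinom : ℝ) / 4^m * ((-1)^j * (m.choose j / (2*j+1)))) := by
  have hP : (∑ S : Finset (Fin (2*m+1)), monomial S.card (c S) : ℝ[X])
      = (1 - 2 * ∑ k ∈ Finset.range (m+1), bernsteinPolynomial ℝ (2*m+1) k).comp
          (C (1/2) * (1 + X)) := by
    apply Polynomial.funext
    intro t
    have := maj_eval m c hc t
    simp only [eval_finsetSum, eval_monomial, this]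
    simp [bernsteinPolynomial, eval_finsetSum, ← div_eq_inv_mul]
  have h0 : (∑ S : Finset (Fin (2*m+1)), monomial S.card (c S) : ℝ[X]).eval 0 = 0 := by
    have := maj_eval m c hc 0
    simp only [eval_finsetSum, eval_monomial, this]
    have hh := Nat.sum_range_choose_halfway m
    have hh' : ∑ k ∈ Finset.range (m+1), ((2*m+1).choose k : ℝ) = 4^m := by exact_mod_cast hh
    have : ∀ k ∈ Finset.range (m+1), ((2*m+1).choose k : ℝ) * ((1+0)/2)^k * (1 - (1+0)/2)^(2*m+1-k)
        = ((2*m+1).choose k : ℝ) * (1/2)^(2*m+1) := by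
      intro k hk
      have hk' : k ≤ 2*m+1 := by have := Finset.mem_range.mp hk; omega
      rw [mul_assoc, show (1 - (1+0)/2 : ℝ) = 1/2 by norm_num, add_zero, ← pow_add,
        Nat.add_sub_cancel' hk']
    rw [Finset.sum_congr rfl this, ← Finset.sum_mul, hh', pow_succ, pow_mul]
    have : (4:ℝ)^m * (((1/2)^2)^m) = 1 := by rw [← mul_pow]; norm_num
    linear_combination (-1:ℝ) * this
  have hd : derivative (∑ S : Finset (Fin (2*m+1)), monomial S.card (c S) : ℝ[X])
      = derivative (∑ j ∈ Finset.range (m+1), monomial (2*j+1)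
          ((2*m+1) * (m.centralBinom : ℝ) / 4^m * ((-1)^j * (m.choose j / (2*j+1))))) := by
    rw [hP, derivative_comp]
    rw [derivative_sub, derivative_mul (f := 2), maj_bern_deriv (2*m) m]
    apply Polynomial.funext
    intro t
    have hb : ∀ j ∈ Finset.range (m+1), (2*m+1) * (m.centralBinom : ℝ) / 4^m * ((-1)^j * (m.choose j / (2*j+1)))
        * (2*(j:ℝ)+1) * t^(2*j) = (2*m+1) * (m.centralBinom : ℝ) / 4^m * ((-t^2)^j * 1^(m-j) * m.choose j) := by
      intro j _
      have : (2*(j:ℝ)+1) ≠ 0 := by positivity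
      rw [neg_pow (t^2), one_pow, ← pow_mul]
      field_simp
    simp only [derivative_sum, derivative_monomial, eval_finsetSum, eval_monomial]
    push_cast
    rw [Finset.sum_congr rfl hb, ← Finset.mul_sum, ← add_pow]
    simp [bernsteinPolynomial, ← Nat.centralBinom_eq_two_mul_choose]
    rw [show 2*m-m = m by omega]
    have : (-t^2+1)^m = 4^m * ((2⁻¹*(1+t))^m * (1 - 2⁻¹*(1+t))^m) := by
      rw [← mul_pow, ← mul_pow]; congr 1; ring
    rw [this]
    field_simp
    ring
  have hsub := (Polynomial.derivative_eq_zero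
    (p := (∑ S : Finset (Fin (2*m+1)), monomial S.card (c S) : ℝ[X]) - ∑ j ∈ Finset.range (m+1), monomial (2*j+1)
          ((2*m+1) * (m.centralBinom : ℝ) / 4^m * ((-1)^j * (m.choose j / (2*j+1)))))).mp (by
      rw [derivative_sub, hd, sub_self])
  rw [Polynomial.natDegree_eq_zero] at hsub
  obtain ⟨z, hz⟩ := hsub
  have hz0 : z = 0 := by
    have := congrArg (eval 0) hz
    rw [eval_sub, h0] at this
    simpa [eval_finsetSum] using this
  rw [hz0, C_0] at hz
  exact sub_eq_zero.mp hz.symm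


/-- failure of unbiased low-degree truncation for majority.
For odd `n`, let `f_n` be the unique multilinear polynomial (with coefficients `c` over
subsets of coordinates) agreeing with the majority function on `{-1,1}ⁿ`, and let
`f_n^{≤d}` be its truncation to monomials of total degree at most `d`.  For all
`0 < a < b < 1` there is `δ ∈ (0,1)` such that for every `C > 0` and all large enough
odd `n` there exists `t ∈ [a,b]` with `|f_n^{≤⌊δn⌋}(t,…,t)| ≥ C`. -/
theorem majority_unbiased_truncation_blowup
    (a b : ℝ) (ha : 0 < a) (hab : a < b) (hb : b < 1) :
    ∃ δ ∈ Set.Ioo (0 : ℝ) 1, ∀ C > (0 : ℝ), ∃ n₀ : ℕ, ∀ n ≥ n₀, Odd n →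
      ∀ c : Finset (Fin n) → ℝ,
        (∀ x : Fin n → ℝ, (∀ i, x i = 1 ∨ x i = -1) →
          (∑ S : Finset (Fin n), c S * ∏ i ∈ S, x i)
            = if 0 < ∑ i, x i then 1 else -1) →
        ∃ t ∈ Set.Icc a b,
          C ≤ |∑ S ∈ Finset.univ.filter (fun S : Finset (Fin n) => S.card ≤ ⌊δ * n⌋₊),
                c S * t ^ S.card| := by
  have ha1 : a < 1 := hab.trans hb
  have ha2 : a^2 < 1 := by nlinarith
  have ha2' : 0 < a^2 := by positivity
  refine ⟨a^2/20, ⟨by positivity, by linarith⟩, ?_⟩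
  intro C hC
  obtain ⟨n₀, hn₀⟩ := exists_nat_ge ((4*C/a+3)/(a^2/20))
  refine ⟨n₀, ?_⟩
  intro n hn hodd c hc
  refine ⟨a, ⟨le_refl _, hab.le⟩, ?_⟩
  obtain ⟨m, rfl⟩ := hodd
  set d := ⌊a^2/20 * ((2*m+1 : ℕ):ℝ)⌋₊ with hd
  have hbig : 4*C/a+3 ≤ a^2/20 * ((2*m+1:ℕ):ℝ) := by
    have : (n₀:ℝ) ≤ ((2*m+1:ℕ):ℝ) := by exact_mod_cast hn
    have := hn₀.trans this
    rw [div_le_iff₀ (by positivity)] at this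
    linarith
  have hCa : 0 < C / a := by positivity
  have hd1 : (d:ℝ) ≤ a^2/20 * ((2*m+1 : ℕ):ℝ) := Nat.floor_le (by positivity)
  have hd2 : a^2/20 * ((2*m+1 : ℕ):ℝ) < d + 1 := Nat.lt_floor_add_one _
  have hd3 : 3 ≤ d := Nat.le_floor (by push_cast at hbig ⊢; rw [mul_div_assoc] at hbig; linarith)
  have hdn : d ≤ 2*m+1 := by
    have : (d:ℝ) ≤ ((2*m+1:ℕ):ℝ) := hd1.trans (by
      have : (0:ℝ) ≤ ((2*m+1:ℕ):ℝ) := by positivity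
      nlinarith)
    exact_mod_cast this
  have hp := maj_poly m c hc
  have h1 := maj_trunc_aux Finset.univ (fun S : Finset (Fin (2*m+1)) => S.card) c d a
  rw [hp, maj_trunc_aux] at h1
  rw [← h1]
  obtain ⟨J, hJ⟩ : ∃ J, J = (d-1)/2 := ⟨_, rfl⟩
  have hfil : (Finset.range (m+1)).filter (fun j => 2*j+1 ≤ d) = Finset.range (J+1) := by
    ext j; simp; omega
  rw [hfil]
  set T : ℕ → ℝ := fun j => (m.choose j : ℝ) * a^(2*j+1) / (2*j+1) with hT
  have hterm : ∀ j ∈ Finset.range (J+1), (2*m+1) * (m.centralBinom : ℝ) / 4^m *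
      ((-1)^j * (m.choose j / (2*j+1))) * a^(2*j+1)
      = (2*m+1) * (m.centralBinom : ℝ) / 4^m * ((-1)^j * T j) := by
    intro j _; simp only [hT]; ring
  rw [Finset.sum_congr rfl hterm, ← Finset.mul_sum]
  have hT0 : T 0 = a := by simp [hT]
  have hgrow : ∀ j < J, 2 * T j ≤ T (j+1) := by
    intro j hj
    have hjm : j ≤ m := by omega
    have hch := Nat.choose_succ_right_eq m j
    have hch' : (m.choose (j+1) : ℝ) * (j+1) = m.choose j * (m - j) := by
      have := congrArg (Nat.cast (R := ℝ)) hch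
      push_cast [Nat.cast_sub hjm] at this
      exact this
    have hjd : (2*((j:ℝ)+1)) ≤ d := by
      have : 2*(j+1) ≤ d := by omega
      exact_mod_cast this
    have hj0 : (0:ℝ) ≤ j := by positivity
    have hm0 : (0:ℝ) ≤ m := by positivity
    push_cast at hd1
    have hk : 6*((j:ℝ)+1) ≤ (m - j) * a^2 := by nlinarith
    have hk2 : 2*((j:ℝ)+1)*(2*j+3) ≤ (m - j) * a^2 * (2*j+1) := by nlinarith
    have hTj : T (j+1) = (m.choose j * a^(2*j+1)) * ((m - j) * a^2 / ((j+1) * (2*j+3))) := by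
      have : (m.choose (j+1) : ℝ) = m.choose j * (m - j) / (j+1) := by
        rw [eq_div_iff (by positivity)]; exact hch'
      simp only [hT]
      rw [this]
      push_cast
      rw [show 2 * ((j:ℝ)+1) + 1 = 2*j+3 by ring]
      field_simp
      ring
    have hTj' : 2 * T j = (m.choose j * a^(2*j+1)) * (2 / (2*j+1)) := by
      simp only [hT]; ring
    rw [hTj, hTj']
    apply mul_le_mul_of_nonneg_left _ (by positivity)
    rw [div_le_div_iff₀ (by positivity) (by positivity)]
    linarith
  obtain ⟨q1, q2, -⟩ := maj_alt_aux T J (by rw [hT0]; exact ha.le) hgrow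
  rw [hT0] at q1
  have hcn : 1 ≤ (2*(m:ℝ)+1) * (m.centralBinom : ℝ) / 4^m := by
    rw [le_div_iff₀ (by positivity), one_mul]
    have h := Nat.four_pow_le_two_mul_self_mul_centralBinom m (by omega)
    have h' : (4:ℝ)^m ≤ 2 * m * m.centralBinom := by exact_mod_cast h
    have : (0:ℝ) ≤ m.centralBinom := by positivity
    linarith
  have hJ2 : (J:ℝ) ≤ 2^J := by exact_mod_cast Nat.lt_two_pow_self.le
  have hJ3 : (d:ℝ) ≤ 2*J+2 := by
    have : d ≤ 2*J+2 := by omega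
    exact_mod_cast this
  have hJC : 2 * C / a ≤ J := by
    rw [mul_div_assoc] at hbig ⊢; linarith
  rw [div_le_iff₀ ha] at hJC
  have hfin : C ≤ |∑ j ∈ Finset.range (J+1), (-1)^j * T j| := by
    have : |∑ j ∈ Finset.range (J+1), (-1)^j * T j| = |(-1)^J * ∑ j ∈ Finset.range (J+1), (-1)^j * T j| := by
      rw [abs_mul, abs_pow]; simp
    rw [this]
    refine le_trans ?_ (le_abs_self _)
    nlinarith
  rw [abs_mul, abs_of_nonneg (by linarith)]
  have := abs_nonneg (∑ j ∈ Finset.range (J+1), (-1)^j * T j)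
  nlinarith
end
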